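/- Let G be a finite group and let X and X' be finitely generated G-modules. If for some i, r ∈ ℤ there is a natural isomorphism of functors Ĥ^i(G, X' ⊗_ℤ −) ≅ Ĥ^{i+r}(G, X ⊗_ℤ −) on the category of G-modules, then (X, X') is an r-encoding pair. -/

import Mathlib

/-!
This file sets up Tate cohomology of a finite group `G` (with coefficients in objects of
`Rep ℤ G`), realized concretely in each degree `n ∈ ℤ` as
`Ĥ^n(G, M) = Ĥ⁰(G, Hom_ℤ(J n, M))`, where `J n` is the standard `n`-th syzygy of the
trivial module `ℤ` (the `n`-th tensor power of the augmentation ideal `I_G` for `n ≥ 0`,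
and of its `ℤ`-linear dual for `n < 0`), and `Ĥ⁰` denotes invariants modulo norms.
Cup products are induced by the canonical comparison maps `J (i+j) ⟶ J i ⊗ J j`.
-/

open CategoryTheory MonoidalCategory TensorProduct

set_option linter.unusedSectionVars false
set_option maxHeartbeats 1000000

attribute [instance 0] AddCommGroup.toIntModule

namespace Enc

variable {k : Type} [CommRing k] {G : Type} [Group G] [Fintype G]

/-! ### Degree-zero Tate cohomology: invariants modulo norms -/

section Aux
variable {V V₂ : Type} [AddCommGroup V] [Module k V] [AddCommGroup V₂] [Module k V₂]

/-- The norm map `v ↦ ∑_{g ∈ G} g • v` of a representation. -/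
noncomputable def rnorm (ρ : Representation k G V) : V →ₗ[k] V := ∑ g : G, ρ g

lemma rnorm_mem_invariants (ρ : Representation k G V) (v : V) :
    rnorm ρ v ∈ ρ.invariants := by
  intro g
  show (ρ g) ((∑ h : G, ρ h) v) = _
  simp only [LinearMap.sum_apply, map_sum]
  rw [Fintype.sum_equiv (Equiv.mulLeft g) _ (fun h => ρ h v) (fun h => by
    rw [← Module.End.mul_apply, ← map_mul]; rfl)]
  simp [rnorm]

/-- The norm map, viewed as landing in the invariants. -/
noncomputable def rnormRes (ρ : Representation k G V) : V →ₗ[k] ρ.invariants :=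
  (rnorm ρ).codRestrict ρ.invariants (rnorm_mem_invariants ρ)

/-- The image of the norm map, inside the invariants. -/
noncomputable def rnormIm (ρ : Representation k G V) : Submodule k ρ.invariants :=
  LinearMap.range (rnormRes ρ)

/-- Degree-zero Tate cohomology of a representation: invariants modulo norms. -/
noncomputable def tate0 (ρ : Representation k G V) : Type :=
  ρ.invariants ⧸ rnormIm ρ

noncomputable instance (ρ : Representation k G V) : AddCommGroup (tate0 ρ) :=
  inferInstanceAs (AddCommGroup (ρ.invariants ⧸ rnormIm ρ))

noncomputable instance (ρ : Representation k G V) : Module k (tate0 ρ) :=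
  inferInstanceAs (Module k (ρ.invariants ⧸ rnormIm ρ))

/-- The Tate class of an invariant vector. -/
noncomputable def tate0mk {ρ : Representation k G V} (v : V) (hv : v ∈ ρ.invariants) :
    tate0 ρ := Submodule.Quotient.mk (⟨v, hv⟩ : ρ.invariants)

lemma invariants_comp {ρ : Representation k G V} {σ : Representation k G V₂}
    (f : V →ₗ[k] V₂) (hf : ∀ (g : G) (v : V), f (ρ g v) = σ g (f v)) :
    ∀ x ∈ ρ.invariants, f x ∈ σ.invariants := by
  intro x hx g
  rw [← hf g x, hx g]

/-- Functoriality of degree-zero Tate cohomology along equivariant maps. -/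
noncomputable def tate0map {ρ : Representation k G V} {σ : Representation k G V₂}
    (f : V →ₗ[k] V₂) (hf : ∀ (g : G) (v : V), f (ρ g v) = σ g (f v)) :
    tate0 ρ →ₗ[k] tate0 σ :=
  Submodule.mapQ (rnormIm ρ) (rnormIm σ) (f.restrict (invariants_comp f hf))
    (by
      rintro ⟨x, hx⟩ ⟨y, hy⟩
      refine ⟨f y, ?_⟩
      apply Subtype.ext
      have hy' := congrArg Subtype.val hy
      show rnorm σ (f y) = _
      simp only [LinearMap.restrict_apply]
      have : rnorm σ (f y) = f (rnorm ρ y) := by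
        simp only [rnorm, LinearMap.sum_apply, map_sum]
        exact Finset.sum_congr rfl fun g _ => (hf g y).symm
      rw [this]
      exact congrArg f hy')

end Aux

/-- Degree-zero Tate cohomology `Ĥ⁰(G, W) = W^G / N_G W` of an object of `Rep k G`. -/
noncomputable def H0T (W : Rep k G) : Type := tate0 W.ρ

noncomputable instance (W : Rep k G) : AddCommGroup (H0T W) :=
  inferInstanceAs (AddCommGroup (tate0 W.ρ))

noncomputable instance (W : Rep k G) : Module k (H0T W) :=
  inferInstanceAs (Module k (tate0 W.ρ))

/-- Functoriality of `Ĥ⁰` along morphisms of representations. -/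
noncomputable def H0Tmap {W W' : Rep k G} (ψ : W ⟶ W') : H0T W →ₗ[k] H0T W' :=
  tate0map ψ.hom (fun g v => Rep.hom_comm_apply ψ g v)

/-! ### The augmentation ideal and the syzygy modules `J n` -/

variable (G)

/-- The augmentation map `ℤ[G] → ℤ`. -/
noncomputable def aug : (G →₀ ℤ) →ₗ[ℤ] ℤ :=
  Finsupp.linearCombination ℤ (fun _ : G => (1 : ℤ))

/-- The permutation representation of `G` on `H →₀ k` induced by a `G`-action on `H`. -/
noncomputable def ofMulActionFinsupp (k : Type*) [CommSemiring k] (G : Type*) [Monoid G]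
    (H : Type*) [MulAction G H] : Representation k G (H →₀ k) where
  toFun g := Finsupp.lmapDomain k k (g • ·)
  map_one' := by ext; simp
  map_mul' x y := by ext; simp [mul_smul]

lemma aug_comm (g : G) (x : G →₀ ℤ) :
    aug G (ofMulActionFinsupp ℤ G G g x) = aug G x := by
  unfold aug
  simp [ofMulActionFinsupp, Finsupp.linearCombination_apply]
  rw [Finsupp.sum_mapDomain_index] <;> simp

/-- The underlying `ℤ`-module of the augmentation ideal. -/
noncomputable abbrev IGcar : Type := LinearMap.ker (aug G)

/-- The representation of `G` on the augmentation ideal. -/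
noncomputable def IGρ : Representation ℤ G (IGcar G) where
  toFun g := (ofMulActionFinsupp ℤ G G g).restrict (p := LinearMap.ker (aug G))
    (q := LinearMap.ker (aug G)) (by
      intro x hx
      simp only [LinearMap.mem_ker] at hx ⊢
      rw [aug_comm]; exact hx)
  map_one' := by ext x; simp [LinearMap.restrict_apply]
  map_mul' g h := by ext x; simp [LinearMap.restrict_apply, Module.End.mul_apply]

/-- The augmentation ideal `I_G` of `ℤ[G]`, as an object of `Rep ℤ G`. -/
noncomputable def IGrep : Rep ℤ G := Rep.of (IGρ G)

/-- `Hom_ℤ(X, A)` with the conjugation `G`-action, i.e. the internal hom in `Rep ℤ G`. -/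
noncomputable abbrev hRep {G : Type} [Group G] (X A : Rep.{0} ℤ G) : Rep.{0} ℤ G :=
  (Rep.ihom X).obj A

/-- The `ℤ`-linear dual of the augmentation ideal, as an object of `Rep ℤ G`. -/
noncomputable def DIG : Rep ℤ G := hRep (IGrep G) (𝟙_ (Rep ℤ G))

instance : Module.Finite ℤ (IGcar G) := by
  have : Module.Finite ℤ (G →₀ ℤ) :=
    Module.Finite.equiv (Finsupp.linearEquivFunOnFinite ℤ ℤ G).symm
  exact Module.Finite.of_injective (LinearMap.ker (aug G)).subtype Subtype.val_injective

instance : Module.Free ℤ (IGcar G) := by infer_instance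

/-- Nonnegative tensor powers `I_G^{⊗ n}` (with `I_G^{⊗ 0} = ℤ`). -/
noncomputable def Jp : ℕ → Rep ℤ G
  | 0 => 𝟙_ (Rep ℤ G)
  | n + 1 => Jp n ⊗ IGrep G

/-- Tensor powers of the dual of the augmentation ideal. -/
noncomputable def Jn : ℕ → Rep ℤ G
  | 0 => 𝟙_ (Rep ℤ G)
  | n + 1 => Jn n ⊗ DIG G

/-- The standard syzygy modules of the trivial representation `ℤ`, indexed by `ℤ`:
`J n = I_G^{⊗ n}` for `n ≥ 0`, and `J n = (I_G^∨)^{⊗ (-n)}` for `n < 0`. -/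
noncomputable def J : ℤ → Rep ℤ G
  | .ofNat n => Jp G n
  | .negSucc n => Jn G (n + 1)

lemma J_ofNat (m : ℕ) : J G (m : ℤ) = Jp G m := rfl

lemma J_neg (m : ℕ) : J G (-(m : ℤ)) = Jn G m := by cases m <;> rfl

/-- The element of `(I_G)^∨ ⊗ I_G` corresponding to the identity map. -/
noncomputable def preElt : Module.Dual ℤ (IGcar G) ⊗[ℤ] IGcar G :=
  (dualTensorHomEquiv ℤ (IGcar G) (IGcar G)).symm LinearMap.id

/-- The canonical element of `I_G ⊗ (I_G)^∨` corresponding to the identity map. -/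
noncomputable def coevElt : (IGrep G ⊗ DIG G).V :=
  (TensorProduct.comm ℤ _ _) (preElt G)

lemma conj_dualTensor (g : G) (t : Module.Dual ℤ (IGcar G) ⊗[ℤ] IGcar G) :
    dualTensorHom ℤ _ _ (TensorProduct.map ((DIG G).ρ g) ((IGrep G).ρ g) t)
      = (IGrep G).ρ g ∘ₗ (dualTensorHom ℤ _ _ t) ∘ₗ (IGrep G).ρ g⁻¹ := by
  have key (a : Module.Dual ℤ (IGcar G) →ₗ[ℤ] Module.Dual ℤ (IGcar G))
      (b c : IGcar G →ₗ[ℤ] IGcar G) (h : ∀ f, a f = f ∘ₗ c) :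
      dualTensorHom ℤ (IGcar G) (IGcar G) (TensorProduct.map a b t)
        = b ∘ₗ (dualTensorHom ℤ (IGcar G) (IGcar G) t) ∘ₗ c := by
    induction t with
    | zero => simp
    | tmul f v =>
        apply LinearMap.ext
        intro w
        simp only [TensorProduct.map_tmul, dualTensorHom_apply,
          LinearMap.comp_apply, map_smul, h]
    | add x y hx hy =>
        simp only [map_add, hx, hy, LinearMap.add_comp, LinearMap.comp_add]
  exact key _ _ _ fun f => LinearMap.ext fun _ => rfl

lemma coevElt_invariant (g : G) :
    ((IGrep G ⊗ DIG G).ρ g) (coevElt G) = coevElt G := by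
  show TensorProduct.map ((IGrep G).ρ g) ((DIG G).ρ g)
      ((TensorProduct.comm ℤ _ _) (preElt G)) = _
  refine (TensorProduct.map_comm ((IGrep G).ρ g) ((DIG G).ρ g) (preElt G)).trans ?_
  show (TensorProduct.comm ℤ _ _) (TensorProduct.map ((DIG G).ρ g) ((IGrep G).ρ g) (preElt G))
      = (TensorProduct.comm ℤ _ _) (preElt G)
  congr 1
  apply (dualTensorHomEquiv ℤ (IGcar G) (IGcar G)).injective
  have h2 : dualTensorHom ℤ (IGcar G) (IGcar G) (preElt G) = LinearMap.id :=
    (dualTensorHomEquiv ℤ (IGcar G) (IGcar G)).apply_symm_apply LinearMap.id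
  show dualTensorHom ℤ (IGcar G) (IGcar G)
      (TensorProduct.map ((DIG G).ρ g) ((IGrep G).ρ g) (preElt G))
    = dualTensorHom ℤ (IGcar G) (IGcar G) (preElt G)
  refine (conj_dualTensor G g (preElt G)).trans ?_
  show (IGrep G).ρ g ∘ₗ dualTensorHom ℤ (IGcar G) (IGcar G) (preElt G) ∘ₗ (IGrep G).ρ g⁻¹
      = dualTensorHom ℤ (IGcar G) (IGcar G) (preElt G)
  rw [h2]
  apply LinearMap.ext
  intro v
  exact Representation.self_inv_apply (IGrep G).ρ g v

/-- The coevaluation `ℤ ⟶ I_G ⊗ I_G^∨`. -/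
noncomputable def coev : 𝟙_ (Rep ℤ G) ⟶ IGrep G ⊗ DIG G :=
  Rep.ofHom (ρ := (𝟙_ (Rep ℤ G)).ρ) (σ := (IGrep G ⊗ DIG G).ρ) {
  toLinearMap := LinearMap.toSpanSingleton ℤ _ (coevElt G)
  isIntertwining' := by
    intro g
    apply LinearMap.ext
    intro z
    show LinearMap.toSpanSingleton ℤ _ (coevElt G) ((𝟙_ (Rep ℤ G)).ρ g z)
        = ((IGrep G ⊗ DIG G).ρ g) (LinearMap.toSpanSingleton ℤ _ (coevElt G) z)
    have hz : ((𝟙_ (Rep ℤ G)).ρ g z) = z := rfl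
    rw [hz]
    show z • coevElt G = ((IGrep G ⊗ DIG G).ρ g) (z • coevElt G)
    rw [map_smul, coevElt_invariant] }


variable {G}

/-- One-step comparison `J (n+1) ⟶ J n ⊗ I_G`. -/
noncomputable def sMap : ∀ n : ℤ, J G (n + 1) ⟶ J G n ⊗ IGrep G
  | .ofNat m => 𝟙 (Jp G m ⊗ IGrep G)
  | .negSucc 0 =>
      coev G ≫ (β_ (IGrep G) (DIG G)).hom ≫ ((λ_ (DIG G)).inv ▷ IGrep G)
  | .negSucc (m+1) =>
      (ρ_ (Jn G (m+1))).inv ≫ (Jn G (m+1) ◁ (coev G ≫ (β_ (IGrep G) (DIG G)).hom))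
        ≫ (α_ (Jn G (m+1)) (DIG G) (IGrep G)).inv

/-- One-step comparison `J (n-1) ⟶ J n ⊗ I_G^∨`. -/
noncomputable def tMap : ∀ n : ℤ, J G (n - 1) ⟶ J G n ⊗ DIG G
  | .ofNat 0 => 𝟙 (𝟙_ (Rep ℤ G) ⊗ DIG G)
  | .ofNat (m+1) =>
      eqToHom (congrArg (J G) (show (Int.ofNat (m+1)) - 1 = ((m:ℕ) : ℤ) by
        rw [Int.ofNat_eq_coe]; push_cast; ring)) ≫
      (ρ_ (Jp G m)).inv ≫ (Jp G m ◁ coev G) ≫ (α_ (Jp G m) (IGrep G) (DIG G)).inv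
  | .negSucc m => eqToHom (show J G (Int.negSucc m - 1) = J G (Int.negSucc m) ⊗ DIG G from rfl)

/-- Comparison maps `J (i + m) ⟶ J i ⊗ J m` for `m ≥ 0`. -/
noncomputable def μpos (i : ℤ) : ∀ m : ℕ, J G (i + m) ⟶ J G i ⊗ J G (m : ℤ)
  | 0 => eqToHom (congrArg (J G) (by omega)) ≫ (ρ_ (J G i)).inv
  | m + 1 =>
      eqToHom (congrArg (J G) (show i + ((m:ℕ)+1:ℕ) = (i + m) + 1 by omega))
        ≫ sMap (i + m) ≫ (μpos i m ▷ IGrep G) ≫ (α_ (J G i) (J G (m:ℤ)) (IGrep G)).hom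

/-- Comparison maps `J (i - m) ⟶ J i ⊗ J (-m)` for `m ≥ 0`. -/
noncomputable def μneg (i : ℤ) : ∀ m : ℕ, J G (i - m) ⟶ J G i ⊗ J G (-(m : ℤ))
  | 0 => eqToHom (congrArg (J G) (by omega)) ≫ (ρ_ (J G i)).inv
  | m + 1 =>
      eqToHom (congrArg (J G) (show i - ((m:ℕ)+1:ℕ) = (i - m) - 1 by omega))
        ≫ tMap (i - m) ≫ (μneg i m ▷ DIG G) ≫ (α_ (J G i) (J G (-(m:ℤ))) (DIG G)).hom
        ≫ (J G i ◁ (eqToHom (show J G (-(m:ℤ)) ⊗ DIG G = J G (-((m:ℕ)+1:ℕ)) by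
            rw [J_neg, J_neg]; rfl)))

variable (G)

/-- The canonical comparison map `J (i+j) ⟶ J i ⊗ J j`, implementing the standard stable
equivalences between the syzygies `J`; it induces the cup product on Tate cohomology. -/
noncomputable def μ (i : ℤ) : ∀ j : ℤ, J G (i + j) ⟶ J G i ⊗ J G j
  | .ofNat m => μpos i m
  | .negSucc m =>
      eqToHom (congrArg (J G) (show i + Int.negSucc m = i - ((m+1 : ℕ) : ℤ) by
        rw [Int.negSucc_eq]; push_cast; ring))
        ≫ μneg i (m+1)

variable {G}

/-! ### Tate cohomology in all degrees, functoriality, cup products -/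

/-- Tate cohomology `Ĥ^n(G, M)` of the finite group `G` with coefficients in `M : Rep ℤ G`,
realized as `Ĥ⁰(G, Hom_ℤ(J n, M))` for the standard `n`-th syzygy `J n` of `ℤ`. -/
noncomputable def tate (n : ℤ) (M : Rep ℤ G) : Type := H0T (hRep (J G n) M)

noncomputable instance (n : ℤ) (M : Rep ℤ G) : AddCommGroup (tate n M) :=
  inferInstanceAs (AddCommGroup (H0T (hRep (J G n) M)))

/-- The map on Tate cohomology induced by a morphism of representations. -/
noncomputable def tmap (n : ℤ) {M N : Rep ℤ G} (φ : M ⟶ N) : tate n M → tate n N :=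
  H0Tmap ((Rep.ihom (J G n)).map φ)

/-- Transport of Tate cohomology along an equality of degrees. -/
noncomputable def tcast {i j : ℤ} {M : Rep ℤ G} (h : i = j) (z : tate i M) : tate j M :=
  h ▸ z

lemma hom_invariant {X W : Rep.{0} ℤ G} (m : X ⟶ W) :
    m.hom.toLinearMap ∈ (hRep X W).ρ.invariants := by
  intro g
  show W.ρ g ∘ₗ m.hom.toLinearMap ∘ₗ X.ρ g⁻¹ = m.hom.toLinearMap
  ext v
  simp only [LinearMap.comp_apply]
  erw [Rep.hom_comm_apply m g⁻¹ v, Representation.self_inv_apply]; rfl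

/-- The Tate cohomology class of a `G`-equivariant map `J n ⟶ W`. -/
noncomputable def mkCls {n : ℤ} {W : Rep ℤ G} (m : J G n ⟶ W) : tate n W :=
  tate0mk m.hom.toLinearMap (hom_invariant m)


lemma tensor_rho_eq (M N : Rep ℤ G) (g : G) :
    (M ⊗ N).ρ g = TensorProduct.map (M.ρ g) (N.ρ g) := rfl

section MapAux
variable {P A B C D : Type} [AddCommGroup P] [Module k P] [AddCommGroup A] [Module k A]
  [AddCommGroup B] [Module k B] [AddCommGroup C] [Module k C] [AddCommGroup D] [Module k D]

lemma map_conj_comp {m : P →ₗ[k] A ⊗[k] B} {r : P →ₗ[k] P} {a : A →ₗ[k] A} {b : B →ₗ[k] B}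
    (u : A →ₗ[k] C) (w : B →ₗ[k] D) (c : C →ₗ[k] C) (d : D →ₗ[k] D)
    (hm : m ∘ₗ r = TensorProduct.map a b ∘ₗ m) :
    TensorProduct.map (c ∘ₗ u ∘ₗ a) (d ∘ₗ w ∘ₗ b) ∘ₗ m
      = TensorProduct.map c d ∘ₗ (TensorProduct.map u w ∘ₗ m) ∘ₗ r := by
  rw [LinearMap.comp_assoc, hm, TensorProduct.map_comp, TensorProduct.map_comp]
  rfl

lemma map_sum_comp_left {ι : Type} (t : Finset ι) (u : ι → A →ₗ[k] C) (w : B →ₗ[k] D)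
    (m : P →ₗ[k] A ⊗[k] B) :
    TensorProduct.map (∑ h ∈ t, u h) w ∘ₗ m = ∑ h ∈ t, TensorProduct.map (u h) w ∘ₗ m := by
  classical
  induction t using Finset.induction_on with
  | empty => simp [TensorProduct.map_zero_left]
  | insert x t hx ih =>
      rw [Finset.sum_insert hx, Finset.sum_insert hx, TensorProduct.map_add_left,
        LinearMap.add_comp, ih]

lemma map_sum_comp_right {ι : Type} (t : Finset ι) (u : A →ₗ[k] C) (w : ι → B →ₗ[k] D)
    (m : P →ₗ[k] A ⊗[k] B) :
    TensorProduct.map u (∑ h ∈ t, w h) ∘ₗ m = ∑ h ∈ t, TensorProduct.map u (w h) ∘ₗ m := by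
  classical
  induction t using Finset.induction_on with
  | empty => simp [TensorProduct.map_zero_right]
  | insert x t hx ih =>
      rw [Finset.sum_insert hx, Finset.sum_insert hx, TensorProduct.map_add_right,
        LinearMap.add_comp, ih]

lemma map_sub_comp_left (u u' : A →ₗ[k] C) (w : B →ₗ[k] D) (m : P →ₗ[k] A ⊗[k] B) :
    TensorProduct.map (u - u') w ∘ₗ m
      = TensorProduct.map u w ∘ₗ m - TensorProduct.map u' w ∘ₗ m := by
  apply eq_sub_of_add_eq
  rw [← LinearMap.add_comp, ← TensorProduct.map_add_left, sub_add_cancel]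

lemma map_sub_comp_right (u : A →ₗ[k] C) (w w' : B →ₗ[k] D) (m : P →ₗ[k] A ⊗[k] B) :
    TensorProduct.map u (w - w') ∘ₗ m
      = TensorProduct.map u w ∘ₗ m - TensorProduct.map u w' ∘ₗ m := by
  apply eq_sub_of_add_eq
  rw [← LinearMap.add_comp, ← TensorProduct.map_add_right, sub_add_cancel]

end MapAux

lemma cup_invariance {i j : ℤ} {M N : Rep ℤ G}
    (f : ((hRep (J G i) M).ρ.invariants))
    (g : ((hRep (J G j) N).ρ.invariants)) :
    (TensorProduct.map f.1 g.1).comp ((μ G i j).hom.toLinearMap)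
      ∈ (hRep (J G (i + j)) (M ⊗ N)).ρ.invariants := by
  intro gg
  have hf : M.ρ gg ∘ₗ f.1 ∘ₗ (J G i).ρ gg⁻¹ = f.1 := f.2 gg
  have hg : N.ρ gg ∘ₗ g.1 ∘ₗ (J G j).ρ gg⁻¹ = g.1 := g.2 gg
  have hμ : (μ G i j).hom.toLinearMap.comp ((J G (i + j)).ρ gg⁻¹)
      = (TensorProduct.map ((J G i).ρ gg⁻¹) ((J G j).ρ gg⁻¹)).comp (μ G i j).hom.toLinearMap := by
    have h := (μ G i j).hom.isIntertwining' gg⁻¹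
    exact h
  show (M ⊗ N).ρ gg ∘ₗ ((TensorProduct.map f.1 g.1).comp (μ G i j).hom.toLinearMap)
        ∘ₗ (J G (i + j)).ρ gg⁻¹
      = (TensorProduct.map f.1 g.1).comp (μ G i j).hom.toLinearMap
  refine (map_conj_comp f.1 g.1 (M.ρ gg) (N.ρ gg) hμ).symm.trans ?_
  exact congrArg₂ (fun (x : (J G i).V →ₗ[ℤ] M.V) (y : (J G j).V →ₗ[ℤ] N.V) =>
    (TensorProduct.map x y).comp (μ G i j).hom.toLinearMap) hf hg

lemma conj_term {i j : ℤ} {M N : Rep ℤ G} (u : (J G i).V →ₗ[ℤ] M.V)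
    (w : (J G j).V →ₗ[ℤ] N.V) (h : G) :
    (TensorProduct.map (M.ρ h ∘ₗ u ∘ₗ (J G i).ρ h⁻¹) (N.ρ h ∘ₗ w ∘ₗ (J G j).ρ h⁻¹)).comp
        (μ G i j).hom.toLinearMap
      = ((hRep (J G (i + j)) (M ⊗ N)).ρ h) ((TensorProduct.map u w).comp (μ G i j).hom.toLinearMap) := by
  have hμ : (μ G i j).hom.toLinearMap ∘ₗ (J G (i + j)).ρ h⁻¹
      = TensorProduct.map ((J G i).ρ h⁻¹) ((J G j).ρ h⁻¹) ∘ₗ (μ G i j).hom.toLinearMap := by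
    have hc := (μ G i j).hom.isIntertwining' h⁻¹
    exact hc
  show _ = (M ⊗ N).ρ h ∘ₗ ((TensorProduct.map u w).comp (μ G i j).hom.toLinearMap) ∘ₗ (J G (i + j)).ρ h⁻¹
  exact map_conj_comp u w (M.ρ h) (N.ρ h) hμ

lemma cup_norm_left {i j : ℤ} {M N : Rep ℤ G} (u : (J G i).V →ₗ[ℤ] M.V)
    (g : ((hRep (J G j) N).ρ.invariants)) :
    (TensorProduct.map (rnorm ((hRep (J G i) M).ρ) u) g.1).comp (μ G i j).hom.toLinearMap
      = rnorm ((hRep (J G (i + j)) (M ⊗ N)).ρ)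
          ((TensorProduct.map u g.1).comp (μ G i j).hom.toLinearMap) := by
  have h1 : rnorm ((hRep (J G i) M).ρ) u = ∑ h : G, ((hRep (J G i) M).ρ h) u := by
    exact LinearMap.sum_apply _ _ _
  have h2 : rnorm ((hRep (J G (i + j)) (M ⊗ N)).ρ) ((TensorProduct.map u g.1).comp (μ G i j).hom.toLinearMap)
      = ∑ h : G, ((hRep (J G (i + j)) (M ⊗ N)).ρ h)
          ((TensorProduct.map u g.1).comp (μ G i j).hom.toLinearMap) := by
    exact LinearMap.sum_apply _ _ _
  refine (congrArg (fun x : (J G i).V →ₗ[ℤ] M.V =>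
    (TensorProduct.map x g.1).comp (μ G i j).hom.toLinearMap) h1).trans ?_
  refine (map_sum_comp_left Finset.univ (fun h : G => ((hRep (J G i) M).ρ h) u) g.1
    (μ G i j).hom.toLinearMap).trans ?_
  refine Eq.trans ?_ h2.symm
  refine Finset.sum_congr rfl fun h _ => ?_
  have hginv : N.ρ h ∘ₗ g.1 ∘ₗ (J G j).ρ h⁻¹ = g.1 := g.2 h
  refine Eq.trans ?_ (conj_term u g.1 h)
  exact congrArg (fun y : (J G j).V →ₗ[ℤ] N.V =>
    (TensorProduct.map (M.ρ h ∘ₗ u ∘ₗ (J G i).ρ h⁻¹) y).comp (μ G i j).hom.toLinearMap) hginv.symm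

lemma cup_norm_right {i j : ℤ} {M N : Rep ℤ G}
    (f : ((hRep (J G i) M).ρ.invariants)) (w : (J G j).V →ₗ[ℤ] N.V) :
    (TensorProduct.map f.1 (rnorm ((hRep (J G j) N).ρ) w)).comp (μ G i j).hom.toLinearMap
      = rnorm ((hRep (J G (i + j)) (M ⊗ N)).ρ)
          ((TensorProduct.map f.1 w).comp (μ G i j).hom.toLinearMap) := by
  have h1 : rnorm ((hRep (J G j) N).ρ) w = ∑ h : G, ((hRep (J G j) N).ρ h) w := by
    exact LinearMap.sum_apply _ _ _
  have h2 : rnorm ((hRep (J G (i + j)) (M ⊗ N)).ρ) ((TensorProduct.map f.1 w).comp (μ G i j).hom.toLinearMap)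
      = ∑ h : G, ((hRep (J G (i + j)) (M ⊗ N)).ρ h)
          ((TensorProduct.map f.1 w).comp (μ G i j).hom.toLinearMap) := by
    exact LinearMap.sum_apply _ _ _
  refine (congrArg (fun y : (J G j).V →ₗ[ℤ] N.V =>
    (TensorProduct.map f.1 y).comp (μ G i j).hom.toLinearMap) h1).trans ?_
  refine (map_sum_comp_right Finset.univ f.1 (fun h : G => ((hRep (J G j) N).ρ h) w)
    (μ G i j).hom.toLinearMap).trans ?_
  refine Eq.trans ?_ h2.symm
  refine Finset.sum_congr rfl fun h _ => ?_
  have hfinv : M.ρ h ∘ₗ f.1 ∘ₗ (J G i).ρ h⁻¹ = f.1 := f.2 h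
  refine Eq.trans ?_ (conj_term f.1 w h)
  exact congrArg (fun x : (J G i).V →ₗ[ℤ] M.V =>
    (TensorProduct.map x (N.ρ h ∘ₗ w ∘ₗ (J G j).ρ h⁻¹)).comp (μ G i j).hom.toLinearMap) hfinv.symm

lemma cup_welldef {i j : ℤ} {M N : Rep ℤ G}
    (a₁ : ((hRep (J G i) M).ρ.invariants)) (b₁ : ((hRep (J G j) N).ρ.invariants))
    (a₂ : ((hRep (J G i) M).ρ.invariants)) (b₂ : ((hRep (J G j) N).ρ.invariants))
    (ha : a₁ - a₂ ∈ rnormIm ((hRep (J G i) M).ρ))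
    (hb : b₁ - b₂ ∈ rnormIm ((hRep (J G j) N).ρ)) :
    tate0mk (ρ := (hRep (J G (i + j)) (M ⊗ N)).ρ)
        ((TensorProduct.map a₁.1 b₁.1).comp ((μ G i j).hom.toLinearMap)) (cup_invariance a₁ b₁)
      = tate0mk (ρ := (hRep (J G (i + j)) (M ⊗ N)).ρ)
        ((TensorProduct.map a₂.1 b₂.1).comp ((μ G i j).hom.toLinearMap)) (cup_invariance a₂ b₂) := by
  obtain ⟨u, hu⟩ := ha
  obtain ⟨w, hw⟩ := hb
  have hu' : rnorm ((hRep (J G i) M).ρ) u = a₁.1 - a₂.1 := congrArg Subtype.val hu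
  have hw' : rnorm ((hRep (J G j) N).ρ) w = b₁.1 - b₂.1 := congrArg Subtype.val hw
  have step1 : tate0mk (ρ := (hRep (J G (i + j)) (M ⊗ N)).ρ)
        ((TensorProduct.map a₁.1 b₁.1).comp ((μ G i j).hom.toLinearMap))
        (cup_invariance a₁ b₁)
      = tate0mk (ρ := (hRep (J G (i + j)) (M ⊗ N)).ρ)
        ((TensorProduct.map a₂.1 b₁.1).comp ((μ G i j).hom.toLinearMap)) (cup_invariance a₂ b₁) := by
    refine (Submodule.Quotient.eq _).mpr ?_
    refine ⟨(TensorProduct.map u b₁.1).comp ((μ G i j).hom.toLinearMap), ?_⟩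
    apply Subtype.ext
    refine (cup_norm_left u b₁).symm.trans ?_
    refine (congrArg (fun x : (J G i).V →ₗ[ℤ] M.V =>
      (TensorProduct.map x b₁.1).comp (μ G i j).hom.toLinearMap) hu').trans ?_
    exact map_sub_comp_left a₁.1 a₂.1 b₁.1 (μ G i j).hom.toLinearMap
  have step2 : tate0mk (ρ := (hRep (J G (i + j)) (M ⊗ N)).ρ)
        ((TensorProduct.map a₂.1 b₁.1).comp ((μ G i j).hom.toLinearMap))
        (cup_invariance a₂ b₁)
      = tate0mk (ρ := (hRep (J G (i + j)) (M ⊗ N)).ρ)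
        ((TensorProduct.map a₂.1 b₂.1).comp ((μ G i j).hom.toLinearMap)) (cup_invariance a₂ b₂) := by
    refine (Submodule.Quotient.eq _).mpr ?_
    refine ⟨(TensorProduct.map a₂.1 w).comp ((μ G i j).hom.toLinearMap), ?_⟩
    apply Subtype.ext
    refine (cup_norm_right a₂ w).symm.trans ?_
    refine (congrArg (fun y : (J G j).V →ₗ[ℤ] N.V =>
      (TensorProduct.map a₂.1 y).comp (μ G i j).hom.toLinearMap) hw').trans ?_
    exact map_sub_comp_right a₂.1 b₁.1 b₂.1 (μ G i j).hom.toLinearMap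
  exact step1.trans step2

/-- The cup product `Ĥ^i(G, M) × Ĥ^j(G, N) → Ĥ^{i+j}(G, M ⊗ N)` on Tate cohomology,
induced by the comparison maps `μ`. -/
noncomputable def cup {i j : ℤ} {M N : Rep ℤ G} (z₁ : tate i M) (z₂ : tate j N) :
    tate (i + j) (M ⊗ N) :=
  Quotient.liftOn₂ z₁ z₂
    (fun f g => tate0mk ((TensorProduct.map f.1 g.1).comp ((μ G i j).hom.toLinearMap)) (cup_invariance f g))
    (fun a₁ b₁ a₂ b₂ ha hb => cup_welldef a₁ b₁ a₂ b₂
      ((Submodule.quotientRel_def _).mp ha) ((Submodule.quotientRel_def _).mp hb))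

/-! ### Pairings -/

/-- The composition pairing `Hom_ℤ(B, C) ⊗ Hom_ℤ(A, B) ⟶ Hom_ℤ(A, C)`, `f ⊗ φ ↦ f ∘ φ`. -/
noncomputable def compPair (A B C : Rep ℤ G) : hRep B C ⊗ hRep A B ⟶ hRep A C :=
  MonoidalClosed.curry <|
    (A ◁ (β_ (hRep B C) (hRep A B)).hom) ≫ (α_ A (hRep A B) (hRep B C)).inv
      ≫ (((ihom.ev A).app B) ▷ hRep B C) ≫ (ihom.ev B).app C

/-- The evaluation pairing `Hom_ℤ(X, B) ⊗ X ⟶ B`, `f ⊗ x ↦ f x`. -/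
noncomputable def evPair (X B : Rep ℤ G) : hRep X B ⊗ X ⟶ B :=
  (β_ (hRep X B) X).hom ≫ (ihom.ev X).app B

/-- The cup product `Ĥ^i(G, Hom(X, A)) × Ĥ^j(G, Hom(X', X)) → Ĥ^{i+j}(G, Hom(X', A))`
induced by the composition pairing. -/
noncomputable def ccup {i j : ℤ} {X X' A : Rep ℤ G}
    (z : tate i (hRep X A)) (x : tate j (hRep X' X)) : tate (i + j) (hRep X' A) :=
  tmap (i + j) (compPair X' X A) (cup z x)

/-- `ccup`, with the degree of the target adjusted along an equality of integers. -/
noncomputable def ccupTo {i j m : ℤ} {X X' A : Rep ℤ G}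
    (z : tate i (hRep X A)) (x : tate j (hRep X' X)) (h : i + j = m) :
    tate m (hRep X' A) :=
  tcast h (ccup z x)

/-- The class of the identity in `Ĥ⁰(G, Hom_ℤ(X, X))`. -/
noncomputable def idCls (X : Rep ℤ G) : tate 0 (hRep X X) :=
  mkCls (MonoidalClosed.curry (ρ_ X).hom)

/-! ### Encoding pairs and related notions -/

/-- `(X, X')` is an *`r`-encoding pair* if for some `i ∈ ℤ` there is a natural isomorphism
of functors `Ĥ^i(G, Hom_ℤ(X, -)) ≅ Ĥ^{i+r}(G, Hom_ℤ(X', -))` on `Rep ℤ G`. -/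
def IsEncodingPair {G : Type} [Group G] [Fintype G] (r : ℤ) (X X' : Rep ℤ G) : Prop :=
  ∃ (i : ℤ) (e : ∀ A : Rep ℤ G, tate i (hRep X A) ≃+ tate (i + r) (hRep X' A)),
    ∀ {A B : Rep ℤ G} (φ : A ⟶ B) (z : tate i (hRep X A)),
      e B (tmap i ((Rep.ihom X).map φ) z) = tmap (i + r) ((Rep.ihom X').map φ) (e A z)

/-- `x ∈ Ĥ^r(G, Hom_ℤ(X', X))` is an *encoding element* for the pair `(X, X')` if it has a
*decoding element* `x' ∈ Ĥ^{-r}(G, Hom_ℤ(X, X'))` with `x' ∪ x = [id_{X'}]` and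
`x ∪ x' = [id_X]`. -/
def IsEncodingElement {G : Type} [Group G] [Fintype G] {r : ℤ} (X X' : Rep ℤ G)
    (x : tate r (hRep X' X)) : Prop :=
  ∃ x' : tate (-r) (hRep X X'),
    ccupTo x' x (by ring) = idCls X' ∧ ccupTo x x' (by ring) = idCls X

/-- The induced `G`-module `ℤ[G] ⊗_ℤ A ≅ (G →₀ A)`, with `G` acting by left translation. -/
noncomputable def indRep (G : Type) [Group G] (A : Type) [AddCommGroup A] [Module ℤ A] :
    Rep ℤ G :=
  Rep.of (G := G) (X := G →₀ A)
    { toFun := fun g => Finsupp.lmapDomain A ℤ (fun h => g * h)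
      map_one' := by
        ext x h
        simp [Finsupp.lmapDomain_apply, Finsupp.mapDomain_id, one_mul]
      map_mul' := fun g g' => by
        ext x h
        simp [Finsupp.lmapDomain_apply, Module.End.mul_apply, Finsupp.mapDomain_single,
          mul_assoc] }

/-- A `G`-module is *induced* if it is isomorphic to `ℤ[G] ⊗_ℤ A` for some abelian group `A`. -/
def IsInduced {G : Type} [Group G] (M : Rep ℤ G) : Prop :=
  ∃ (A : Type) (_ : AddCommGroup A) (_ : Module ℤ A), Nonempty (M ≅ indRep G A)

/-- A class `φ ∈ Ĥ⁰(G, Hom_ℤ(X, X))` is a unit for the (composition) cup product. -/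
def IsUnitCls {G : Type} [Group G] [Fintype G] {X : Rep ℤ G}
    (φ : tate 0 (hRep X X)) : Prop :=
  ∃ ψ : tate 0 (hRep X X),
    ccupTo φ ψ (by ring) = idCls X ∧ ccupTo ψ φ (by ring) = idCls X


/-- The natural map `Hom_ℤ(X, A) ⊗ I_G ⟶ Hom_ℤ(X, A ⊗ I_G)`, `f ⊗ z ↦ (x ↦ f x ⊗ z)`. -/
noncomputable def pr0 (X A : Rep ℤ G) : hRep X A ⊗ IGrep G ⟶ hRep X (A ⊗ IGrep G) :=
  MonoidalClosed.curry ((α_ X (hRep X A) (IGrep G)).inv ≫ ((ihom.ev X).app A ▷ IGrep G))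

/-- The natural evaluation map `Hom_ℤ(X, Hom_ℤ(I_G, A)) ⊗ I_G ⟶ Hom_ℤ(X, A)`,
`f ⊗ z ↦ (x ↦ f x z)`. -/
noncomputable def pr1 (X A : Rep ℤ G) :
    hRep X (hRep (IGrep G) A) ⊗ IGrep G ⟶ hRep X A :=
  MonoidalClosed.curry ((α_ X (hRep X (hRep (IGrep G) A)) (IGrep G)).inv
    ≫ ((ihom.ev X).app (hRep (IGrep G) A) ▷ IGrep G) ≫ evPair (IGrep G) A)

/-- The natural evaluation map `Hom_ℤ(X', X) ⊗ (X' ⊗ A) ⟶ X ⊗ A`. -/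
noncomputable def tPair (X' X A : Rep ℤ G) : hRep X' X ⊗ (X' ⊗ A) ⟶ X ⊗ A :=
  (α_ (hRep X' X) X' A).inv ≫ (evPair X' X ▷ A)

/-- A functor `Rep ℤ G ⥤ Rep ℤ G` sends `ℤ`-split short exact sequences of `G`-modules to
short exact sequences of `G`-modules. -/
def PreservesZSplitSES {G : Type} [Group G] (F : Rep.{0} ℤ G ⥤ Rep.{0} ℤ G) : Prop :=
  ∀ (A B C : Rep ℤ G) (f : A ⟶ B) (g : B ⟶ C),
    Function.Injective f.hom → Function.Surjective g.hom → Function.Exact f.hom g.hom →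
    (∃ s : C.V →+ B.V, ∀ x, g.hom (s x) = x) →
    Function.Injective (F.map f).hom ∧ Function.Surjective (F.map g).hom ∧
      Function.Exact (F.map f).hom (F.map g).hom

/-- A *shiftable functor*: it sends `ℤ`-split short exact sequences of `G`-modules to short
exact sequences, and sends induced modules to induced modules. -/
def Shiftable {G : Type} [Group G] (F : Rep ℤ G ⥤ Rep ℤ G) : Prop :=
  PreservesZSplitSES F ∧ ∀ M : Rep ℤ G, IsInduced M → IsInduced (F.obj M)

end Enc

namespace Enc

/-! ### Part A: characters of abelian groups -/

/-- The dualizing group `ℚ/ℤ`. -/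
abbrev QZ : Type := AddCircle (1 : ℚ)

section Chars

variable {A B : Type} [AddCommGroup A] [AddCommGroup B]

lemma char_fac (f : A →ₗ[ℤ] B) (c : A →ₗ[ℤ] QZ) (h : ∀ a, f a = 0 → c a = 0) :
    ∃ c' : B →ₗ[ℤ] QZ, ∀ a, c' (f a) = c a := by
  have hk : LinearMap.ker f ≤ LinearMap.ker c := fun a ha => h a ha
  have hinj : Function.Injective ((LinearMap.ker f).liftQ f le_rfl) := by
    rw [← LinearMap.ker_eq_bot]
    exact Submodule.ker_liftQ_eq_bot _ _ _ le_rfl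
  have hB : Module.Baer ℤ QZ := Module.Baer.of_divisible _
  obtain ⟨c', hc'⟩ := hB.extension_property ((LinearMap.ker f).liftQ f le_rfl) hinj
    ((LinearMap.ker f).liftQ c hk)
  refine ⟨c', fun a => ?_⟩
  have := LinearMap.congr_fun hc' (Submodule.Quotient.mk a)
  simpa using this

lemma char_sep {a : A} (h : ∀ c : A →ₗ[ℤ] QZ, c a = 0) : a = 0 := by
  apply CharacterModule.eq_zero_of_character_apply
  intro c
  exact h (AddMonoidHom.toIntLinearMap c)

lemma char_sep_sub (S : Submodule ℤ A) {a : A}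
    (h : ∀ c : A →ₗ[ℤ] QZ, (∀ s ∈ S, c s = 0) → c a = 0) : a ∈ S := by
  rw [← Submodule.Quotient.mk_eq_zero]
  apply char_sep
  intro c
  exact h (c ∘ₗ S.mkQ) (fun s hs => by simp [(Submodule.Quotient.mk_eq_zero S).mpr hs])

lemma finite_fg_torsion [Module.Finite ℤ A] (n : ℤ) (hn : n ≠ 0)
    (h : ∀ a : A, n • a = 0) : Finite A := by
  apply Module.finite_of_fg_torsion A
  intro a
  exact ⟨⟨n, mem_nonZeroDivisors_of_ne_zero hn⟩, h a⟩

noncomputable def qzToCircle : QZ →+ Additive Circle :=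
  QuotientAddGroup.lift _
    ((AddMonoidHom.mk' (fun q : ℚ => Additive.ofMul (Circle.exp (2 * Real.pi * q))) (by
      intro a b; rw [← ofMul_mul, ← Circle.exp_add]; push_cast; ring_nf)))
    (by
      intro x hx
      obtain ⟨n, rfl⟩ := AddSubgroup.mem_zmultiples_iff.mp hx
      show Circle.exp _ = 1
      rw [Circle.exp_eq_one]
      exact ⟨n, by simp; ring⟩)

lemma qzToCircle_injective : Function.Injective qzToCircle := by
  rw [injective_iff_map_eq_zero]
  intro x
  induction x using QuotientAddGroup.induction_on with
  | H q =>
    intro h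
    have h' : Circle.exp (2 * Real.pi * q) = 1 := h
    rw [Circle.exp_eq_one] at h'
    obtain ⟨n, hn⟩ := h'
    have : (q : ℝ) = n := by
      have hp := Real.pi_pos
      have : (2 * Real.pi) * (q - n : ℝ) = 0 := by rw [mul_sub, hn]; ring
      rcases mul_eq_zero.mp this with h | h
      · linarith
      · linarith
    have hq : q = (n : ℚ) := by exact_mod_cast this
    exact (QuotientAddGroup.eq_zero_iff _).mpr
      (AddSubgroup.mem_zmultiples_iff.mpr ⟨n, by simp [hq]⟩)

/-- Comparison with complex characters. -/
noncomputable def toAddChar (c : A →ₗ[ℤ] QZ) : AddChar A Circle where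
  toFun a := (qzToCircle (c a)).toMul
  map_zero_eq_one' := by simp
  map_add_eq_mul' := by intro a b; simp

lemma toAddChar_injective : Function.Injective (toAddChar (A := A)) := by
  intro c d h
  ext a
  exact qzToCircle_injective (congrArg Additive.ofMul (DFunLike.congr_fun h a))

lemma finite_chars [Finite A] : Finite (A →ₗ[ℤ] QZ) ∧ Nat.card (A →ₗ[ℤ] QZ) ≤ Nat.card A := by
  have := Fintype.ofFinite A
  have f : Function.Injective
    (fun c : A →ₗ[ℤ] QZ => AddChar.circleEquivComplex (toAddChar c)) :=
    AddChar.circleEquivComplex.injective.comp toAddChar_injective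
  refine ⟨Finite.of_injective _ f, ?_⟩
  have := Nat.card_le_card_of_injective _ f
  rwa [Nat.card_eq_fintype_card (α := AddChar A ℂ), AddChar.card_eq,
    ← Nat.card_eq_fintype_card] at this

lemma finite_double_dual [Finite A] (w : (A →ₗ[ℤ] QZ) →ₗ[ℤ] QZ) :
    ∃ a : A, ∀ c, w c = c a := by
  obtain ⟨h1, h2⟩ := finite_chars (A := A)
  obtain ⟨h3, h4⟩ := finite_chars (A := A →ₗ[ℤ] QZ)
  let ev : A → ((A →ₗ[ℤ] QZ) →ₗ[ℤ] QZ) := fun a => LinearMap.applyₗ a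
  have hinj : Function.Injective ev := by
    intro a b h
    rw [← sub_eq_zero]
    apply char_sep
    intro c
    rw [map_sub, sub_eq_zero]
    exact LinearMap.congr_fun h c
  have hb : Function.Bijective ev := by
    have := Fintype.ofFinite A
    have := Fintype.ofFinite ((A →ₗ[ℤ] QZ) →ₗ[ℤ] QZ)
    rw [Fintype.bijective_iff_injective_and_card]
    refine ⟨hinj, le_antisymm (Fintype.card_le_of_injective _ hinj) ?_⟩
    simp only [← Nat.card_eq_fintype_card]
    exact h4.trans h2
  obtain ⟨a, ha⟩ := hb.2 w
  exact ⟨a, fun c => by rw [← ha]; rfl⟩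

variable [Module.Finite ℤ A]

lemma dd_split (n : ℤ) (hn : n ≠ 0) (y : (A →ₗ[ℤ] QZ) →ₗ[ℤ] QZ) :
    ∃ (q : A) (z : (A →ₗ[ℤ] QZ) →ₗ[ℤ] QZ), ∀ c, y c = c q + n • z c := by
  let S : Submodule ℤ A := LinearMap.range (n • (LinearMap.id : A →ₗ[ℤ] A))
  have hfin : Finite (A ⧸ S) := by
    apply finite_fg_torsion n hn
    intro a
    induction a using Submodule.Quotient.induction_on with
    | H a =>
      rw [← Submodule.Quotient.mk_smul, Submodule.Quotient.mk_eq_zero]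
      exact ⟨a, rfl⟩
  obtain ⟨q', hq'⟩ := finite_double_dual (A := A ⧸ S) (y ∘ₗ S.mkQ.lcomp ℤ QZ)
  obtain ⟨q, rfl⟩ := Submodule.Quotient.mk_surjective S q'
  obtain ⟨z, hz⟩ := char_fac (n • (LinearMap.id : (A →ₗ[ℤ] QZ) →ₗ[ℤ] (A →ₗ[ℤ] QZ)))
    (y - LinearMap.applyₗ q) (by
      intro c hc
      have hc' : S ≤ LinearMap.ker c := by
        rintro _ ⟨a, rfl⟩
        have := LinearMap.congr_fun hc a
        simpa using this
      have := hq' (S.liftQ c hc')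
      have e : S.mkQ.lcomp ℤ QZ (S.liftQ c hc') = c := by ext; simp
      rw [LinearMap.comp_apply, e] at this
      simp [this])
  refine ⟨q, z, fun c => ?_⟩
  have := hz c
  simp only [LinearMap.smul_apply, LinearMap.id_apply, map_smul, LinearMap.sub_apply,
    LinearMap.applyₗ_apply_apply] at this
  rw [this]; abel

lemma dd_pure (n : ℤ) (hn : n ≠ 0) (y : (A →ₗ[ℤ] QZ) →ₗ[ℤ] QZ) (q : A)
    (h : ∀ c, n • y c = c q) : ∃ q', ∀ c, y c = c q' := by
  have hq : q ∈ LinearMap.range (n • (LinearMap.id : A →ₗ[ℤ] A)) := by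
    apply char_sep_sub
    intro c hc
    rw [← h]
    have : n • c = 0 := by
      ext a
      have := hc (n • a) ⟨a, rfl⟩
      simpa using this
    rw [← map_smul, this, map_zero]
  obtain ⟨q1, hq1⟩ := hq
  simp only [LinearMap.smul_apply, LinearMap.id_apply] at hq1
  let T : Submodule ℤ A := LinearMap.ker (n • (LinearMap.id : A →ₗ[ℤ] A))
  have hfin : Finite T := by
    apply finite_fg_torsion n hn
    rintro ⟨a, ha⟩
    exact Subtype.ext ha
  obtain ⟨w, hw⟩ := char_fac (T.subtype.lcomp ℤ QZ) (y - LinearMap.applyₗ q1) (by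
    intro c hc
    obtain ⟨d, hd⟩ := char_fac (n • (LinearMap.id : A →ₗ[ℤ] A)) c (by
      intro a ha
      exact LinearMap.congr_fun hc ⟨a, ha⟩)
    have e : c = n • d := by
      ext a; rw [← hd a]; simp
    rw [e]
    rw [map_smul, LinearMap.sub_apply, LinearMap.applyₗ_apply_apply, smul_sub, h, ← hq1,
      map_smul, sub_self])
  obtain ⟨t, ht⟩ := finite_double_dual w
  refine ⟨q1 + t, fun c => ?_⟩
  have h1 := hw c
  rw [ht] at h1
  simp only [LinearMap.sub_apply, LinearMap.applyₗ_apply_apply, LinearMap.lcomp_apply,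
    Submodule.subtype_apply] at h1
  rw [map_add, h1]; abel

/-- Assemble pointwise representing elements to a linear map. -/
lemma dd_lift (y : (A →ₗ[ℤ] QZ) →ₗ[ℤ] (B →ₗ[ℤ] QZ)) (h : ∀ b, ∃ a : A, ∀ c, y c b = c a) :
    ∃ f : B →ₗ[ℤ] A, ∀ c b, y c b = c (f b) := by
  choose f hf using h
  have uniq : ∀ a a' : A, (∀ c : A →ₗ[ℤ] QZ, c a = c a') → a = a' := by
    intro a a' h
    rw [← sub_eq_zero]
    apply char_sep
    intro c
    rw [map_sub, h, sub_self]
  refine ⟨⟨⟨f, ?_⟩, ?_⟩, fun c b => hf b c⟩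
  · intro b b'
    apply uniq
    intro c
    rw [map_add, ← hf, ← hf, ← hf, map_add]
  · intro m b
    apply uniq
    intro c
    simp only [RingHom.id_apply]
    rw [map_smul, ← hf, ← hf, map_smul]

lemma hom_pure (n : ℤ) (hn : n ≠ 0) (y : (A →ₗ[ℤ] QZ) →ₗ[ℤ] (B →ₗ[ℤ] QZ)) (f : B →ₗ[ℤ] A)
    (h : ∀ c b, n • y c b = c (f b)) : ∃ f' : B →ₗ[ℤ] A, ∀ c b, y c b = c (f' b) := by
  apply dd_lift
  intro b
  exact dd_pure n hn (LinearMap.applyₗ b ∘ₗ y) (f b) (fun c => h c b)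

lemma hom_split [Module.Finite ℤ B] (n : ℤ) (hn : n ≠ 0)
    (y : (A →ₗ[ℤ] QZ) →ₗ[ℤ] (B →ₗ[ℤ] QZ)) :
    ∃ (f : B →ₗ[ℤ] A) (z : (A →ₗ[ℤ] QZ) →ₗ[ℤ] (B →ₗ[ℤ] QZ)),
      ∀ c b, y c b = c (f b) + n • z c b := by
  let T := Submodule.torsion ℤ B
  have hfree : Module.Free ℤ (B ⧸ T) := inferInstance
  obtain ⟨s, hs⟩ := Module.projective_lifting_property T.mkQ (LinearMap.id) T.mkQ_surjective
  -- torsion part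
  have htor : ∀ b : B, T.mkQ b = 0 → ∃ a : A, ∀ c, y c b = c a := by
    intro b hb
    have hb' : b ∈ T := by simpa using hb
    obtain ⟨⟨m, hm⟩, hmb⟩ := (Submodule.mem_torsion_iff b).mp hb'
    have hmb' : m • b = 0 := hmb
    refine dd_pure m (nonZeroDivisors.ne_zero hm) (LinearMap.applyₗ b ∘ₗ y) 0 ?_
    intro c
    simp [← map_smul, hmb']
  obtain ⟨f1, hf1⟩ := dd_lift ((LinearMap.id - s ∘ₗ T.mkQ).lcomp ℤ QZ ∘ₗ y) (by
    intro b
    refine htor _ ?_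
    have := LinearMap.congr_fun hs (T.mkQ b)
    simp only [LinearMap.comp_apply, LinearMap.id_apply] at this
    simp only [LinearMap.sub_apply, LinearMap.id_apply, LinearMap.comp_apply, map_sub, this,
      sub_self])
  -- free part
  let bas := Module.Free.chooseBasis ℤ (B ⧸ T)
  have hdd := fun i => dd_split n hn (LinearMap.applyₗ (s (bas i)) ∘ₗ y)
  choose q z hz using hdd
  let f2 : (B ⧸ T) →ₗ[ℤ] A := bas.constr ℤ q
  let z2 : (B ⧸ T) →ₗ[ℤ] ((A →ₗ[ℤ] QZ) →ₗ[ℤ] QZ) := bas.constr ℤ z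
  have key : ∀ x : B ⧸ T, ∀ c, y c (s x) = c (f2 x) + n • z2 x c := by
    intro x c
    have : y c ∘ₗ s = c ∘ₗ f2 + n • (LinearMap.applyₗ c ∘ₗ z2) := by
      apply bas.ext
      intro i
      simpa [f2, z2] using hz i c
    exact LinearMap.congr_fun this x
  refine ⟨f1 + f2 ∘ₗ T.mkQ, T.mkQ.lcomp ℤ QZ ∘ₗ z2.flip, fun c b => ?_⟩
  have h1 := hf1 c b
  have h2 := key (T.mkQ b) c
  simp only [LinearMap.comp_apply, LinearMap.lcomp_apply, LinearMap.sub_apply,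
    LinearMap.id_apply, map_sub] at h1
  simp only [LinearMap.comp_apply, LinearMap.lcomp_apply, LinearMap.add_apply, map_add,
    LinearMap.flip_apply]
  rw [← h1, h2]; abel

end Chars

section CharsGen

variable {A B : Type} [AddCommGroup A] [iA : Module ℤ A] [AddCommGroup B] [iB : Module ℤ B]

lemma char_fac' (f : A →ₗ[ℤ] B) (c : A →ₗ[ℤ] QZ) (h : ∀ a, f a = 0 → c a = 0) :
    ∃ c' : B →ₗ[ℤ] QZ, ∀ a, c' (f a) = c a := by
  obtain rfl := Subsingleton.elim iA (AddCommGroup.toIntModule A)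
  obtain rfl := Subsingleton.elim iB (AddCommGroup.toIntModule B)
  exact char_fac f c h

lemma char_inj {a a' : A} (h : ∀ c : A →ₗ[ℤ] QZ, c a = c a') : a = a' := by
  obtain rfl := Subsingleton.elim iA (AddCommGroup.toIntModule A)
  rw [← sub_eq_zero]
  apply char_sep
  intro c
  rw [map_sub, h, sub_self]

lemma hom_pure' (hA : Module.Finite ℤ A) (n : ℤ) (hn : n ≠ 0)
    (y : (A →ₗ[ℤ] QZ) →ₗ[ℤ] (B →ₗ[ℤ] QZ)) (f : B →ₗ[ℤ] A)
    (h : ∀ c b, n • y c b = c (f b)) : ∃ f' : B →ₗ[ℤ] A, ∀ c b, y c b = c (f' b) := by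
  obtain rfl := Subsingleton.elim iA (AddCommGroup.toIntModule A)
  obtain rfl := Subsingleton.elim iB (AddCommGroup.toIntModule B)
  exact hom_pure n hn y f h

lemma hom_split' (hA : Module.Finite ℤ A) (hB : Module.Finite ℤ B) (n : ℤ) (hn : n ≠ 0)
    (y : (A →ₗ[ℤ] QZ) →ₗ[ℤ] (B →ₗ[ℤ] QZ)) :
    ∃ (f : B →ₗ[ℤ] A) (z : (A →ₗ[ℤ] QZ) →ₗ[ℤ] (B →ₗ[ℤ] QZ)),
      ∀ c b, y c b = c (f b) + n • z c b := by
  obtain rfl := Subsingleton.elim iA (AddCommGroup.toIntModule A)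
  obtain rfl := Subsingleton.elim iB (AddCommGroup.toIntModule B)
  exact hom_split n hn y

end CharsGen

end Enc

namespace Enc

variable {G : Type} [Group G] [Fintype G]

/-! ### Part B: the duality pairing -/

section Pairing

variable {M : Type} [AddCommGroup M] [Module ℤ M] (ρ : Representation ℤ G M)

/-- `m ⊗ x ↦ x(h) m`. -/
noncomputable def kap (M : Type) [AddCommGroup M] [Module ℤ M] (h : G) :
    (M ⊗[ℤ] IGcar G) →ₗ[ℤ] M :=
  (TensorProduct.rid ℤ M).toLinearMap ∘ₗ
    TensorProduct.map LinearMap.id (Finsupp.lapply h ∘ₗ (LinearMap.ker (aug G)).subtype)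

lemma kap_tmul (h : G) (m : M) (x : IGcar G) : kap M h (m ⊗ₜ x) = LinearMap.toSpanSingleton ℤ M m (x.1 h) := by
  simp [kap]

/-- The element `g - 1` of the augmentation ideal. -/
noncomputable def bas (g : G) : IGcar G :=
  ⟨Finsupp.single g 1 - Finsupp.single 1 1, by simp [aug]⟩

lemma IGρ_val (g : G) (x : IGcar G) :
    ((IGρ G g x).1 : G →₀ ℤ) = Finsupp.mapDomain (g * ·) x.1 := rfl

lemma IGρ_apply (g h : G) (x : IGcar G) : (IGρ G g x).1 h = x.1 (g⁻¹ * h) := by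
  rw [IGρ_val]
  conv_lhs => rw [show h = g * (g⁻¹ * h) by group]
  exact Finsupp.mapDomain_apply (mul_right_injective g) _ _

lemma IGρ_bas (g h : G) : IGρ G g (bas h) = bas (g * h) - bas g := by
  apply Subtype.ext
  rw [IGρ_val]
  simp [bas, Finsupp.mapDomain_sub, Finsupp.mapDomain_single]

lemma aug_eq_sum (x : G →₀ ℤ) : aug G x = ∑ g, x g := by
  rw [aug, Finsupp.linearCombination_apply, Finsupp.sum_fintype _ _ (by simp)]
  simp

lemma IG_sum (x : IGcar G) : ∑ g, x.1 g = 0 := by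
  rw [← aug_eq_sum]; exact x.2

lemma kap_tprod (g h : G) (t : M ⊗[ℤ] IGcar G) :
    kap M h ((ρ.tprod (IGρ G)) g t) = ρ g (kap M (g⁻¹ * h) t) := by
  induction t with
  | zero => simp
  | tmul m x => simp [Representation.tprod_apply, kap_tmul, IGρ_apply]
  | add x y hx hy => simp only [map_add, hx, hy]

lemma sum_kap (t : M ⊗[ℤ] IGcar G) : ∑ h, kap M h t = 0 := by
  induction t with
  | zero => simp
  | tmul m x => simp only [kap_tmul]; rw [← map_sum, IG_sum, map_zero]
  | add x y hx hy => simp only [map_add, Finset.sum_add_distrib, hx, hy, add_zero]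

lemma sum_bas (x : IGcar G) : ∑ g, x.1 g • bas g = x := by
  apply Subtype.ext
  have e : ((∑ g, x.1 g • bas g : IGcar G) : G →₀ ℤ) = ∑ g, x.1 g • (bas g : IGcar G).1 := by
    rw [← Submodule.subtype_apply, map_sum]; rfl
  rw [e]
  simp only [bas, smul_sub, Finset.sum_sub_distrib]
  rw [← Finset.sum_smul, IG_sum, zero_smul, sub_zero]
  conv_rhs => rw [← Finsupp.univ_sum_single x.1]
  simp

lemma span_tmul_gen {k A B : Type} [CommRing k] [AddCommGroup A] [Module k A] [AddCommGroup B]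
    [Module k B] (m : A) (n : k) (y : B) :
    LinearMap.toSpanSingleton k A m n ⊗ₜ[k] y = m ⊗ₜ[k] (n • y) := by
  rw [LinearMap.toSpanSingleton_apply, TensorProduct.smul_tmul]

lemma span_tmul (m : M) (n : ℤ) (y : IGcar G) :
    LinearMap.toSpanSingleton ℤ M m n ⊗ₜ[ℤ] y = m ⊗ₜ[ℤ] (n • y) := by
  exact span_tmul_gen m n y

lemma sum_kap_bas (t : M ⊗[ℤ] IGcar G) : ∑ g, kap M g t ⊗ₜ[ℤ] bas g = t := by
  induction t with
  | zero => simp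
  | tmul m x =>
    simp only [kap_tmul, span_tmul]
    rw [← TensorProduct.tmul_sum, sum_bas]
  | add x y hx hy =>
    simp only [map_add, TensorProduct.add_tmul, Finset.sum_add_distrib, hx, hy]

/-- `m ↦ ∑ g m ⊗ (g - 1)`. -/
noncomputable def wmap : M →ₗ[ℤ] (M ⊗[ℤ] IGcar G) :=
  ∑ g, (TensorProduct.comm ℤ (IGcar G) M).toLinearMap ∘ₗ
    TensorProduct.mk ℤ (IGcar G) M (bas g) ∘ₗ ρ g

lemma wmap_apply (m : M) : wmap ρ m = ∑ g, ρ g m ⊗ₜ[ℤ] bas g := by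
  simp [wmap]

lemma rnorm_apply (m : M) : rnorm ρ m = ∑ g, ρ g m := by simp [rnorm]

lemma wmap_smul (h : G) (m : M) :
    (ρ.tprod (IGρ G)) h (wmap ρ m) = wmap ρ m - rnorm ρ m ⊗ₜ bas h := by
  simp only [wmap_apply, map_sum, Representation.tprod_apply, TensorProduct.map_tmul, IGρ_bas,
    TensorProduct.tmul_sub, Finset.sum_sub_distrib, ← TensorProduct.sum_tmul]
  congr 1
  · exact Fintype.sum_equiv (Equiv.mulLeft h) _ _ (fun g => by simp)
  · congr 1
    rw [rnorm_apply]
    exact Fintype.sum_equiv (Equiv.mulLeft h) _ _ (fun g => by simp)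

lemma kap_wmap (m : M) : kap M (1 : G) (wmap ρ m) = m - rnorm ρ m := by
  classical
  have h : ∀ g : G, kap M (1 : G) (ρ g m ⊗ₜ[ℤ] bas g) = (if g = 1 then ρ g m else 0) - ρ g m := by
    intro g
    rw [kap_tmul]
    have : (bas g : IGcar G).1 1 = (if g = 1 then 1 else 0) - 1 := by
      simp [bas, Finsupp.single_apply]
    rw [this, map_sub]
    split_ifs <;> simp only [map_zero, LinearMap.toSpanSingleton_apply_one]
  simp only [wmap_apply, map_sum, h, rnorm_apply, Finset.sum_sub_distrib]
  simp

lemma wmap_sub (h : G) (m : M) :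
    wmap ρ (ρ h m) - wmap ρ m = rnorm (ρ.tprod (IGρ G)) (m ⊗ₜ bas h⁻¹) := by
  rw [rnorm_apply]
  simp only [wmap_apply, Representation.tprod_apply, TensorProduct.map_tmul, IGρ_bas,
    TensorProduct.tmul_sub, Finset.sum_sub_distrib]
  congr 1
  exact Fintype.sum_equiv (Equiv.mulRight h) _ _ (fun g => by simp)

lemma kap_inv (t : M ⊗[ℤ] IGcar G) (ht : ∀ g, (ρ.tprod (IGρ G)) g t = t) (h : G) :
    kap M h t = ρ h (kap M 1 t) := by
  conv_lhs => rw [← ht h]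
  rw [kap_tprod]; simp

lemma rnorm_kap (t : M ⊗[ℤ] IGcar G) (ht : ∀ g, (ρ.tprod (IGρ G)) g t = t) :
    rnorm ρ (kap M 1 t) = 0 := by
  rw [rnorm_apply, ← sum_kap t]
  exact Finset.sum_congr rfl fun g _ => (kap_inv ρ t ht g).symm

lemma wmap_kap (t : M ⊗[ℤ] IGcar G) (ht : ∀ g, (ρ.tprod (IGρ G)) g t = t) :
    wmap ρ (kap M 1 t) = t := by
  rw [wmap_apply]
  conv_rhs => rw [← sum_kap_bas t]
  exact Finset.sum_congr rfl fun g _ => by rw [kap_inv ρ t ht g]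

variable {ρ}

/-- The duality pairing of an invariant character with `Ĥ⁰(M ⊗ I)`. -/
noncomputable def pairR (χ : M →ₗ[ℤ] QZ) (hχ : ∀ g m, χ (ρ g m) = χ m) :
    tate0 (ρ.tprod (IGρ G)) →ₗ[ℤ] QZ :=
  Submodule.liftQ (rnormIm (ρ.tprod (IGρ G)))
    (χ ∘ₗ kap M 1 ∘ₗ (ρ.tprod (IGρ G)).invariants.subtype) (by
      rintro _ ⟨t, rfl⟩
      show χ (kap M 1 (rnorm (ρ.tprod (IGρ G)) t)) = 0
      rw [rnorm_apply]
      simp only [map_sum, kap_tprod, hχ]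
      rw [← map_sum, ← map_zero χ, ← sum_kap t]
      congr 1
      exact Fintype.sum_equiv (Equiv.inv G) _ _ (fun g => by simp))

lemma pairR_mk (χ : M →ₗ[ℤ] QZ) (hχ : ∀ g m, χ (ρ g m) = χ m) (t : M ⊗[ℤ] IGcar G) (ht) :
    pairR χ hχ (tate0mk t ht) = χ (kap M 1 t) := rfl

lemma tate0_ind {V : Type} [AddCommGroup V] [Module ℤ V] {σ : Representation ℤ G V}
    {p : tate0 σ → Prop} (h : ∀ v hv, p (tate0mk v hv)) (z) : p z := by
  obtain ⟨⟨v, hv⟩, rfl⟩ := Submodule.Quotient.mk_surjective _ z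
  exact h v hv

lemma tate0mk_eq {V : Type} [AddCommGroup V] [Module ℤ V] {σ : Representation ℤ G V}
    {v w : V} (hv hw) : (tate0mk v hv : tate0 σ) = tate0mk w hw ↔ ∃ u, rnorm σ u = v - w := by
  constructor
  · intro h
    obtain ⟨u, hu⟩ := (Submodule.Quotient.eq _).mp h
    exact ⟨u, congrArg Subtype.val hu⟩
  · rintro ⟨u, hu⟩
    exact (Submodule.Quotient.eq _).mpr ⟨u, Subtype.ext hu⟩

lemma pairR_norm (χ χ' : M →ₗ[ℤ] QZ) (hχ : ∀ g m, χ (ρ g m) = χ m)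
    (hχ' : ∀ g m, χ' (ρ g m) = χ' m) (ψ : M →ₗ[ℤ] QZ)
    (h : ∀ m, χ m - χ' m = ∑ g, ψ (ρ g⁻¹ m)) : pairR χ hχ = pairR χ' hχ' := by
  apply LinearMap.ext
  apply tate0_ind
  intro t ht
  rw [pairR_mk, pairR_mk, ← sub_eq_zero, h, ← map_sum,
    ← map_zero ψ, ← rnorm_kap ρ t ht, rnorm_apply]
  congr 1
  exact Fintype.sum_equiv (Equiv.inv G) _ _ (fun g => by simp)

lemma pairR_nondeg (χ χ' : M →ₗ[ℤ] QZ) (hχ : ∀ g m, χ (ρ g m) = χ m)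
    (hχ' : ∀ g m, χ' (ρ g m) = χ' m) (h : pairR χ hχ = pairR χ' hχ') :
    ∃ ψ : M →ₗ[ℤ] QZ, ∀ m, χ m - χ' m = ∑ g, ψ (ρ g⁻¹ m) := by
  obtain ⟨ψ, hψ⟩ := char_fac' (rnorm ρ) (χ - χ') (by
    intro m hm
    have hw : wmap ρ m ∈ (ρ.tprod (IGρ G)).invariants := by
      intro g; rw [wmap_smul, hm]; simp
    have := LinearMap.congr_fun h (tate0mk _ hw)
    rw [pairR_mk, pairR_mk, kap_wmap, hm, sub_zero] at this
    simp [this])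
  refine ⟨ψ, fun m => ?_⟩
  rw [← LinearMap.sub_apply, ← hψ, rnorm_apply, map_sum]
  exact Fintype.sum_equiv (Equiv.inv G) _ _ (fun g => by simp)

lemma exists_lin {V : Type} [AddCommGroup V] [i : Module ℤ V] (l : V →+ QZ) :
    ∃ L : V →ₗ[ℤ] QZ, ∀ v, L v = l v := by
  obtain rfl := Subsingleton.elim i (AddCommGroup.toIntModule V)
  exact ⟨l.toIntLinearMap, fun _ => rfl⟩

lemma pairR_surj (l : tate0 (ρ.tprod (IGρ G)) →+ QZ) :
    ∃ (χ : M →ₗ[ℤ] QZ) (hχ : ∀ g m, χ (ρ g m) = χ m), ∀ z, pairR χ hχ z = l z := by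
  let K := LinearMap.ker (rnorm ρ)
  have hK : ∀ m : K, wmap ρ m.1 ∈ (ρ.tprod (IGρ G)).invariants := by
    rintro ⟨m, hm⟩ g; rw [wmap_smul, LinearMap.mem_ker.mp hm]; simp
  let f : K →ₗ[ℤ] tate0 (ρ.tprod (IGρ G)) :=
    (rnormIm (ρ.tprod (IGρ G))).mkQ ∘ₗ (LinearMap.codRestrict _ (wmap ρ ∘ₗ K.subtype) hK)
  obtain ⟨L, hL⟩ := exists_lin l
  obtain ⟨χ, h1⟩ := char_fac' K.subtype (L ∘ₗ f) (by
    intro a ha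
    have : a = 0 := Subtype.ext ha
    rw [this, map_zero])
  have h2 : ∀ m (hm : rnorm ρ m = 0), χ m = l (tate0mk (wmap ρ m) (hK ⟨m, hm⟩)) :=
    fun m hm => (h1 ⟨m, hm⟩).trans (hL _)
  have hχ : ∀ g m, χ (ρ g m) = χ m := by
    intro g m
    have hm : rnorm ρ (ρ g m - m) = 0 := by
      rw [map_sub, sub_eq_zero, rnorm_apply, rnorm_apply]
      exact Fintype.sum_equiv (Equiv.mulRight g) _ _ (fun g => by simp)
    rw [← sub_eq_zero, ← map_sub, h2 _ hm, ← map_zero l]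
    congr 1
    have h0 : (0 : tate0 (ρ.tprod (IGρ G))) = tate0mk 0 (Submodule.zero_mem _) := rfl
    rw [h0, tate0mk_eq]
    exact ⟨m ⊗ₜ bas g⁻¹, by rw [← wmap_sub, map_sub, sub_zero]⟩
  refine ⟨χ, hχ, ?_⟩
  apply tate0_ind
  intro t ht
  rw [pairR_mk, h2 _ (rnorm_kap ρ t ht)]
  congr 1
  rw [tate0mk_eq]
  exact ⟨0, by rw [wmap_kap ρ t ht]; simp⟩

end Pairing

end Enc

namespace Enc

variable {G : Type} [Group G] [Fintype G]

/-! ### Part C: stable equivalence and duality -/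

/-- Build a morphism of representations. -/
noncomputable def mkHom {A B : Rep.{0} ℤ G} (l : A.V →ₗ[ℤ] B.V)
    (h : ∀ g a, l (A.ρ g a) = B.ρ g (l a)) : A ⟶ B :=
  Rep.ofHom (ρ := A.ρ) (σ := B.ρ) { toLinearMap := l, isIntertwining' := fun g => LinearMap.ext (fun a => h g a) }

lemma mkHom_apply {A B : Rep.{0} ℤ G} (l : A.V →ₗ[ℤ] B.V) (h) (a : A.V) :
    (mkHom l h : A ⟶ B).hom a = l a := rfl

/-- Two morphisms agree up to a norm. -/
def StEq {A B : Rep.{0} ℤ G} (f f' : A ⟶ B) : Prop :=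
  ∃ h : A.V →ₗ[ℤ] B.V, ∀ a, f.hom a - f'.hom a = ∑ g, B.ρ g (h (A.ρ g⁻¹ a))

lemma StEq.symm {A B : Rep.{0} ℤ G} {f f' : A ⟶ B} (h : StEq f f') : StEq f' f := by
  obtain ⟨h, hh⟩ := h
  refine ⟨-h, fun a => ?_⟩
  simp only [LinearMap.neg_apply, map_neg, Finset.sum_neg_distrib, ← hh, neg_sub]

lemma StEq.trans {A B : Rep.{0} ℤ G} {f f' f'' : A ⟶ B} (h : StEq f f') (k : StEq f' f'') :
    StEq f f'' := by
  obtain ⟨h, hh⟩ := h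
  obtain ⟨k, hk⟩ := k
  refine ⟨h + k, fun a => ?_⟩
  simp only [LinearMap.add_apply, map_add, Finset.sum_add_distrib, ← hh, ← hk]
  abel

lemma StEq.comp_right {A B C : Rep.{0} ℤ G} {f f' : A ⟶ B} (h : StEq f f') (k : B ⟶ C) :
    StEq (f ≫ k) (f' ≫ k) := by
  obtain ⟨h, hh⟩ := h
  refine ⟨k.hom.toLinearMap ∘ₗ h, fun a => ?_⟩
  have e : ∀ x : A ⟶ B, (x ≫ k).hom a = k.hom (x.hom a) := fun x => rfl
  have e2 : ∀ g, C.ρ g ((k.hom.toLinearMap ∘ₗ h) (A.ρ g⁻¹ a))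
      = k.hom (B.ρ g (h (A.ρ g⁻¹ a))) := fun g => (Rep.hom_comm_apply k g _).symm
  simp only [e, e2]
  rw [← map_sum, ← hh, map_sub]

lemma StEq.comp_left {A B C : Rep.{0} ℤ G} {f f' : B ⟶ C} (h : StEq f f') (k : A ⟶ B) :
    StEq (k ≫ f) (k ≫ f') := by
  obtain ⟨h, hh⟩ := h
  refine ⟨h ∘ₗ k.hom.toLinearMap, fun a => ?_⟩
  have e : ∀ x : B ⟶ C, (k ≫ x).hom a = x.hom (k.hom a) := fun x => rfl
  have e2 : ∀ g, (h ∘ₗ k.hom.toLinearMap) (A.ρ g⁻¹ a) = h (B.ρ g⁻¹ (k.hom a)) :=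
    fun g => congrArg h (Rep.hom_comm_apply k g⁻¹ a)
  simp only [e, e2]
  exact hh _

/-- The character dual of a representation. -/
noncomputable def dualρ {V : Type} [AddCommGroup V] [Module ℤ V] (ρ : Representation ℤ G V) :
    Representation ℤ G (V →ₗ[ℤ] QZ) where
  toFun g := (ρ g⁻¹).lcomp ℤ QZ
  map_one' := by ext; simp
  map_mul' g h := by ext; simp

/-- The character dual of a representation. -/
noncomputable def dRep (P : Rep.{0} ℤ G) : Rep.{0} ℤ G := Rep.of (dualρ P.ρ)

section Gen
variable {k : Type} [CommRing k] {A B C : Type} [AddCommGroup A] [Module k A]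
  [AddCommGroup B] [Module k B] [AddCommGroup C] [Module k C]

/-- Currying with the arguments swapped. -/
noncomputable def curryFlip (ψ : A ⊗[k] B →ₗ[k] C) : B →ₗ[k] A →ₗ[k] C :=
  (TensorProduct.curry ψ).flip

lemma span_comp (f : A →ₗ[k] B) (m : A) (n : k) :
    f (LinearMap.toSpanSingleton k A m n) = LinearMap.toSpanSingleton k B (f m) n := by
  simp

lemma linHom_sum (ρ : Representation k G A) (σ : Representation k G B) (h : A →ₗ[k] B) (a : A) :
    rnorm (Representation.linHom ρ σ) h a = ∑ g, σ g (h (ρ g⁻¹ a)) := by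
  unfold rnorm
  rw [LinearMap.sum_apply, LinearMap.sum_apply]
  rfl

end Gen

/-- The underlying linear map of a morphism into a dual. -/
noncomputable def und {A P : Rep.{0} ℤ G} (c : A ⟶ dRep P) : A.V →ₗ[ℤ] (P.V →ₗ[ℤ] QZ) :=
  c.hom.toLinearMap

lemma und_comm {A P : Rep.{0} ℤ G} (c : A ⟶ dRep P) (g : G) (a : A.V) (p : P.V) :
    und c (A.ρ g a) p = und c a (P.ρ g⁻¹ p) := by
  have := Rep.hom_comm_apply c g a
  exact LinearMap.congr_fun this p

/-- The functional on `P ⊗ A` attached to a map `A ⟶ P^*`. -/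
noncomputable def fn {A P : Rep.{0} ℤ G} (c : A ⟶ dRep P) : (P ⊗ A).V →ₗ[ℤ] QZ :=
  TensorProduct.lift (und c).flip

lemma fn_tmul {A P : Rep.{0} ℤ G} (c : A ⟶ dRep P) (p : P.V) (a : A.V) :
    fn c (p ⊗ₜ[ℤ] a) = und c a p := rfl

lemma fn_inv {A P : Rep.{0} ℤ G} (c : A ⟶ dRep P) (g : G) (t : (P ⊗ A).V) :
    fn c ((P ⊗ A).ρ g t) = fn c t := by
  have : fn c ∘ₗ ((P ⊗ A).ρ g) = fn c := by
    apply TensorProduct.ext'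
    intro p a
    show und c (A.ρ g a) (P.ρ g p) = und c a p
    rw [und_comm]; simp
  exact LinearMap.congr_fun this t

/-- The pairing of maps `A ⟶ P^*` with `Ĥ⁰((P ⊗ A) ⊗ I)`. -/
noncomputable def pr {A P : Rep.{0} ℤ G} (c : A ⟶ dRep P) : H0T ((P ⊗ A) ⊗ IGrep G) →+ QZ :=
  (pairR (ρ := (P ⊗ A).ρ) (fn c) (fn_inv c)).toAddMonoidHom

lemma pr_nondeg {A P : Rep.{0} ℤ G} (c c' : A ⟶ dRep P) (h : ∀ z, pr c z = pr c' z) :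
    StEq c c' := by
  obtain ⟨ψ, hψ⟩ := pairR_nondeg (ρ := (P ⊗ A).ρ) (fn c) (fn c') (fn_inv c) (fn_inv c')
    (LinearMap.ext h)
  refine ⟨curryFlip (A := P.V) (B := A.V) ψ, fun a => ?_⟩
  refine LinearMap.ext fun p => ?_
  refine (hψ (p ⊗ₜ[ℤ] a)).trans ?_
  refine Eq.symm ((LinearMap.sum_apply _ _ _).trans ?_)
  rfl

lemma pr_surj {A P : Rep.{0} ℤ G} (l : H0T ((P ⊗ A) ⊗ IGrep G) →+ QZ) :
    ∃ c : A ⟶ dRep P, ∀ z, pr c z = l z := by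
  obtain ⟨χ, hχ, h⟩ := pairR_surj (ρ := (P ⊗ A).ρ) l
  let u : A.V →ₗ[ℤ] (P.V →ₗ[ℤ] QZ) := curryFlip (A := P.V) (B := A.V) χ
  let c : A ⟶ dRep P := mkHom (B := dRep P) u (by
    intro g a
    refine LinearMap.ext fun p => ?_
    show χ (p ⊗ₜ[ℤ] (A.ρ g a)) = χ (P.ρ g⁻¹ p ⊗ₜ[ℤ] a)
    rw [← hχ g (P.ρ g⁻¹ p ⊗ₜ[ℤ] a)]
    show _ = χ (P.ρ g (P.ρ g⁻¹ p) ⊗ₜ[ℤ] A.ρ g a)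
    simp)
  have hc : fn c = χ := by
    apply TensorProduct.ext'
    intro p a
    rfl
  refine ⟨c, fun z => ?_⟩
  refine Eq.trans ?_ (h z)
  have key : ∀ (χ' : (P ⊗ A).V →ₗ[ℤ] QZ) (h' : ∀ g t, χ' ((P ⊗ A).ρ g t) = χ' t), χ' = χ →
      pairR (ρ := (P ⊗ A).ρ) χ' h' = pairR (ρ := (P ⊗ A).ρ) χ hχ := by
    intro χ' h' e
    subst e
    rfl
  exact LinearMap.congr_fun (key _ (fn_inv c) hc) z

lemma pr_nat {A B P : Rep.{0} ℤ G} (c : A ⟶ dRep P) (φ : B ⟶ A)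
    (z : H0T ((P ⊗ B) ⊗ IGrep G)) :
    pr (φ ≫ c) z = pr c (H0Tmap ((P ◁ φ) ▷ IGrep G) z) := by
  revert z
  refine tate0_ind (σ := ((P ⊗ B) ⊗ IGrep G).ρ) ?_
  intro t ht
  show fn (φ ≫ c) (kap (P ⊗ B).V 1 t) = fn c (kap (P ⊗ A).V 1 (((P ◁ φ) ▷ IGrep G).hom t))
  have h1 : ∀ s : (P ⊗ B).V, fn (φ ≫ c) s = fn c ((P ◁ φ).hom s) := by
    intro s
    have : fn (φ ≫ c) = fn c ∘ₗ (P ◁ φ).hom.toLinearMap := by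
      apply TensorProduct.ext'
      intro p a
      rfl
    exact LinearMap.congr_fun this s
  have h2 : (P ◁ φ).hom.toLinearMap ∘ₗ kap (P ⊗ B).V (1 : G)
      = kap (P ⊗ A).V 1 ∘ₗ ((P ◁ φ) ▷ IGrep G).hom.toLinearMap := by
    apply TensorProduct.ext'
    intro s x
    show (P ◁ φ).hom.toLinearMap (kap (P ⊗ B).V (1 : G) (s ⊗ₜ x))
      = kap (P ⊗ A).V 1 ((P ◁ φ).hom.toLinearMap s ⊗ₜ x)
    rw [kap_tmul, kap_tmul]
    exact span_comp _ _ _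
  rw [h1]
  congr 1
  exact LinearMap.congr_fun h2 t

/-- Matching lemma: a natural isomorphism of `Ĥ⁰((P ⊗ -) ⊗ I)` gives a stable equivalence
of the duals. -/
lemma dual_equiv {P Q : Rep.{0} ℤ G}
    (E : ∀ A : Rep.{0} ℤ G, H0T ((P ⊗ A) ⊗ IGrep G) ≃+ H0T ((Q ⊗ A) ⊗ IGrep G))
    (hE : ∀ {A B : Rep.{0} ℤ G} (φ : A ⟶ B) (z), E B (H0Tmap ((P ◁ φ) ▷ IGrep G) z)
      = H0Tmap ((Q ◁ φ) ▷ IGrep G) (E A z)) :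
    ∃ (v : dRep Q ⟶ dRep P) (u : dRep P ⟶ dRep Q),
      StEq (v ≫ u) (𝟙 _) ∧ StEq (u ≫ v) (𝟙 _) := by
  obtain ⟨v, hv⟩ := pr_surj (P := P) ((pr (𝟙 (dRep Q))).comp (E (dRep Q)).toAddMonoidHom)
  obtain ⟨u, hu⟩ := pr_surj (P := Q) ((pr (𝟙 (dRep P))).comp (E (dRep P)).symm.toAddMonoidHom)
  have hv' : ∀ z, pr v z = pr (𝟙 (dRep Q)) (E _ z) := hv
  have huE : ∀ z, pr u (E _ z) = pr (𝟙 (dRep P)) z := fun z => by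
    rw [hu]
    show pr _ ((E (dRep P)).symm (E (dRep P) z)) = _
    rw [AddEquiv.symm_apply_apply]
  refine ⟨v, u, ?_, ?_⟩
  · apply pr_nondeg
    intro z
    obtain ⟨z, rfl⟩ := (E _).surjective z
    rw [← hv', pr_nat, ← hE, huE, ← pr_nat, Category.comp_id]
  · apply pr_nondeg
    intro z
    rw [pr_nat, hv', hE, ← pr_nat, Category.comp_id, huE]

/-! Removing the dual. -/

section Compare

variable {M N : Type} [AddCommGroup M] [Module ℤ M] [AddCommGroup N] [Module ℤ N]
  (ρ : Representation ℤ G M) (σ : Representation ℤ G N) (j : M →+ N)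
  (hj : ∀ g m, j (ρ g m) = σ g (j m))
  (ha : ∀ y : N, ∃ m z, y = j m + Fintype.card G • z)
  (hb : ∀ (y : N) (m : M), Fintype.card G • y = j m → ∃ m', y = j m')

lemma rnorm_smul (g : G) (y : N) : rnorm σ (σ g y) = rnorm σ y := by
  rw [rnorm_apply, rnorm_apply]
  exact Fintype.sum_equiv (Equiv.mulRight g) _ _ (fun g => by simp)

lemma rnorm_card (z : N) : rnorm σ z = Fintype.card G • z + ∑ g, (σ g z - z) := by
  rw [rnorm_apply, Finset.sum_sub_distrib]
  simp

end Compare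

lemma compare_surj {M N : Type} [AddCommGroup M] [Module ℤ M] [AddCommGroup N] [Module ℤ N]
    (ρ : Representation ℤ G M) (σ : Representation ℤ G N) (j : M →+ N)
    (hj : ∀ g m, j (ρ g m) = σ g (j m)) (hinj : Function.Injective j)
    (ha : ∀ y : N, ∃ m z, y = j m + Fintype.card G • z)
    (hb : ∀ (y : N) (m : M), Fintype.card G • y = j m → ∃ m', y = j m')
    (y : N) (hy : ∀ g, σ g y = y) :
    ∃ m z, (∀ g, ρ g m = m) ∧ j m - y = rnorm σ z := by
  obtain ⟨m0, z, hz⟩ := ha y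
  have h1 : ∀ g, ∃ m, σ g z - z = j m := by
    intro g
    refine hb _ (m0 - ρ g m0) ?_
    have h := hy g
    rw [hz, map_add, ← hj, map_nsmul] at h
    rw [smul_sub, map_sub]
    rw [sub_eq_sub_iff_add_eq_add, add_comm, h, add_comm]
  choose mg hmg using h1
  have h2 : y - rnorm σ z = j (m0 - ∑ g, mg g) := by
    rw [rnorm_card, hz, map_sub, map_sum]
    simp only [hmg]
    abel
  refine ⟨m0 - ∑ g, mg g, -z, fun g => hinj ?_, ?_⟩
  · rw [hj, ← h2, map_sub, hy, rnorm_mem_invariants σ z g]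
  · rw [← h2, map_neg]; abel

lemma compare_inj {M N : Type} [AddCommGroup M] [Module ℤ M] [AddCommGroup N] [Module ℤ N]
    (ρ : Representation ℤ G M) (σ : Representation ℤ G N) (j : M →+ N)
    (hj : ∀ g m, j (ρ g m) = σ g (j m)) (hinj : Function.Injective j)
    (ha : ∀ y : N, ∃ m z, y = j m + Fintype.card G • z)
    (hb : ∀ (y : N) (m : M), Fintype.card G • y = j m → ∃ m', y = j m')
    (m : M) (y : N) (h : j m = rnorm σ y) : ∃ m', m = rnorm ρ m' := by
  have hn : ∀ x, j (rnorm ρ x) = rnorm σ (j x) := fun x => by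
    simp only [rnorm_apply, map_sum, hj]
  obtain ⟨m0, d, hd⟩ := ha y
  obtain ⟨m1, hm1⟩ := hb (rnorm σ d) (m - rnorm ρ m0) (by
    rw [map_sub, hn, h, hd, map_add, map_nsmul]; abel)
  refine ⟨m0 + m1, hinj ?_⟩
  rw [hn, h, hd, map_add j m0 m1, ← hm1]
  have h3 : Fintype.card G • d = rnorm σ d - ∑ g, (σ g d - d) := by
    rw [rnorm_card σ d]; abel
  have h4 : rnorm σ (∑ g, (σ g d - d)) = 0 := by
    rw [map_sum]
    apply Finset.sum_eq_zero
    intro g _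
    rw [map_sub, rnorm_smul, sub_self]
  rw [h3, ← add_sub_assoc, map_sub, h4, sub_zero]

/-- The dual of a morphism. -/
noncomputable def dmap {P Q : Rep.{0} ℤ G} (f : P ⟶ Q) : dRep Q ⟶ dRep P :=
  mkHom (A := dRep Q) (B := dRep P) (f.hom.toLinearMap.lcomp ℤ QZ) (by
    intro g c
    refine LinearMap.ext fun p => ?_
    change Q.V →ₗ[ℤ] QZ at c
    show c (Q.ρ g⁻¹ (f.hom p)) = c (f.hom (P.ρ g⁻¹ p))
    rw [Rep.hom_comm_apply f g⁻¹ p])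

/-- Dualizing linear maps. -/
noncomputable def jmap (P Q : Rep.{0} ℤ G) :
    (P.V →ₗ[ℤ] Q.V) →+ ((Q.V →ₗ[ℤ] QZ) →ₗ[ℤ] (P.V →ₗ[ℤ] QZ)) where
  toFun f := f.lcomp ℤ QZ
  map_zero' := by ext; simp
  map_add' f f' := by ext; simp

lemma jmap_apply (P Q : Rep.{0} ℤ G) (f : P.V →ₗ[ℤ] Q.V) (c : Q.V →ₗ[ℤ] QZ) (p : P.V) :
    jmap P Q f c p = c (f p) := rfl

/-- `jmap` between representations. -/
noncomputable def jmapR (P Q : Rep.{0} ℤ G) :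
    (hRep P Q).V →+ (hRep (dRep Q) (dRep P)).V := jmap P Q

lemma jmap_comm (P Q : Rep.{0} ℤ G) (g : G) (f : (hRep P Q).V) :
    jmapR P Q ((hRep P Q).ρ g f)
      = (hRep (dRep Q) (dRep P)).ρ g (jmapR P Q f) := by
  refine LinearMap.ext fun c => LinearMap.ext fun p => ?_
  change Q.V →ₗ[ℤ] QZ at c
  change P.V →ₗ[ℤ] Q.V at f
  show c (Q.ρ g (f (P.ρ g⁻¹ p))) = c (Q.ρ g⁻¹⁻¹ (f (P.ρ g⁻¹ p)))
  rw [inv_inv]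

lemma hRep_norm (P Q : Rep.{0} ℤ G) (h : P.V →ₗ[ℤ] Q.V) (a : P.V) :
    (show P.V →ₗ[ℤ] Q.V from rnorm (hRep P Q).ρ h) a = ∑ g, Q.ρ g (h (P.ρ g⁻¹ a)) :=
  linHom_sum P.ρ Q.ρ h a

lemma jmap_inj (P Q : Rep.{0} ℤ G) : Function.Injective (jmap P Q) := by
  intro f f' h
  refine LinearMap.ext fun p => char_inj fun c => ?_
  exact LinearMap.congr_fun (LinearMap.congr_fun h c) p

lemma jmap_a (P Q : Rep.{0} ℤ G) (hP : Module.Finite ℤ P.V) (hQ : Module.Finite ℤ Q.V)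
    (y : (Q.V →ₗ[ℤ] QZ) →ₗ[ℤ] (P.V →ₗ[ℤ] QZ)) :
    ∃ m z, y = jmap P Q m + Fintype.card G • z := by
  obtain ⟨f, z, h⟩ := hom_split' hQ hP (Fintype.card G : ℤ) (by simp) y
  refine ⟨f, z, LinearMap.ext fun c => LinearMap.ext fun p => ?_⟩
  rw [h, natCast_zsmul]
  rfl

lemma jmap_b (P Q : Rep.{0} ℤ G) (hQ : Module.Finite ℤ Q.V)
    (y : (Q.V →ₗ[ℤ] QZ) →ₗ[ℤ] (P.V →ₗ[ℤ] QZ)) (m : P.V →ₗ[ℤ] Q.V)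
    (h : Fintype.card G • y = jmap P Q m) : ∃ m', y = jmap P Q m' := by
  obtain ⟨f, h⟩ := hom_pure' hQ (Fintype.card G : ℤ) (by simp) y m (by
    intro c p
    rw [← jmap_apply, ← h, natCast_zsmul]
    rfl)
  exact ⟨f, LinearMap.ext fun c => LinearMap.ext fun p => h c p⟩

lemma dual_full {P Q : Rep.{0} ℤ G} (hP : Module.Finite ℤ P.V) (hQ : Module.Finite ℤ Q.V)
    (v : dRep Q ⟶ dRep P) : ∃ f : P ⟶ Q, StEq (dmap f) v := by
  obtain ⟨m, z, hm, h⟩ := compare_surj (hRep P Q).ρ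
    (hRep (dRep Q) (dRep P)).ρ (jmapR P Q) (jmap_comm P Q) (jmap_inj P Q)
    (jmap_a P Q hP hQ) (jmap_b P Q hQ) v.hom.toLinearMap (fun g => hom_invariant v g)
  change P.V →ₗ[ℤ] Q.V at m
  refine ⟨mkHom m ?_, z, fun c => ?_⟩
  · intro g p
    have h2 : Q.ρ g (m (P.ρ g⁻¹ (P.ρ g p))) = m (P.ρ g p) :=
      LinearMap.congr_fun (hm g) (P.ρ g p)
    rw [← h2]; simp
  · exact (LinearMap.congr_fun h c).trans (hRep_norm (dRep Q) (dRep P) z c)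

lemma dual_faithful {P Q : Rep.{0} ℤ G} (hP : Module.Finite ℤ P.V) (hQ : Module.Finite ℤ Q.V)
    (f f' : P ⟶ Q) (h : StEq (dmap f) (dmap f')) : StEq f f' := by
  obtain ⟨z, hz⟩ := h
  obtain ⟨m, hm⟩ := compare_inj (hRep P Q).ρ
    (hRep (dRep Q) (dRep P)).ρ (jmapR P Q) (jmap_comm P Q) (jmap_inj P Q)
    (jmap_a P Q hP hQ) (jmap_b P Q hQ) (f.hom.toLinearMap - f'.hom.toLinearMap) z (by
      refine LinearMap.ext fun c => ?_
      refine Eq.trans ?_ (hRep_norm (dRep Q) (dRep P) z c).symm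
      refine Eq.trans ?_ (hz c)
      exact LinearMap.congr_fun (map_sub (jmap P Q) f.hom.toLinearMap f'.hom.toLinearMap) c)
  exact ⟨m, fun a => (LinearMap.congr_fun hm a).trans (hRep_norm P Q m a)⟩

theorem core {P Q : Rep.{0} ℤ G} (hP : Module.Finite ℤ P.V) (hQ : Module.Finite ℤ Q.V)
    (E : ∀ A : Rep.{0} ℤ G, H0T ((P ⊗ A) ⊗ IGrep G) ≃+ H0T ((Q ⊗ A) ⊗ IGrep G))
    (hE : ∀ {A B : Rep.{0} ℤ G} (φ : A ⟶ B) (z), E B (H0Tmap ((P ◁ φ) ▷ IGrep G) z)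
      = H0Tmap ((Q ◁ φ) ▷ IGrep G) (E A z)) :
    ∃ (f : P ⟶ Q) (k : Q ⟶ P), StEq (f ≫ k) (𝟙 _) ∧ StEq (k ≫ f) (𝟙 _) := by
  obtain ⟨v, u, h1, h2⟩ := dual_equiv E hE
  obtain ⟨f, hf⟩ := dual_full hP hQ v
  obtain ⟨k, hk⟩ := dual_full hQ hP u
  refine ⟨f, k, dual_faithful hP hP _ _ ?_, dual_faithful hQ hQ _ _ ?_⟩
  · exact ((hf.comp_left (dmap k)).trans (hk.comp_right v)).trans h2
  · exact ((hk.comp_left (dmap f)).trans (hf.comp_right u)).trans h1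

end Enc

namespace Enc

/-! ### Part D: duality for the modules `J n` and conclusion -/

section GenD
variable {k : Type} [CommRing k] {V : Type} [AddCommGroup V] [Module k V]

lemma tri_one (f : Module.Dual k V) (t : Module.Dual k V ⊗[k] V) :
    (contractLeft k V).rTensor (Module.Dual k V) ((TensorProduct.assoc k _ _ _).symm
      (f ⊗ₜ[k] (TensorProduct.comm k _ _ t))) = (1 : k) ⊗ₜ[k] (f ∘ₗ dualTensorHom k V V t) := by
  induction t with
  | zero => simp
  | tmul h v =>
    simp only [TensorProduct.comm_tmul, TensorProduct.assoc_symm_tmul, LinearMap.rTensor_tmul,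
      contractLeft_apply]
    have : f ∘ₗ dualTensorHom k V V (h ⊗ₜ v) = f v • h := by
      ext w
      simp [dualTensorHom_apply, mul_comm]
    rw [this, ← TensorProduct.smul_tmul, smul_eq_mul, mul_one]
  | add x y hx hy =>
    simp only [map_add, TensorProduct.tmul_add, hx, hy, LinearMap.comp_add]

lemma tri_two (v : V) (t : Module.Dual k V ⊗[k] V) :
    (contractLeft k V).lTensor V ((TensorProduct.assoc k _ _ _)
      ((TensorProduct.comm k _ _ t) ⊗ₜ[k] v)) = (dualTensorHom k V V t v) ⊗ₜ[k] (1 : k) := by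
  induction t with
  | zero => simp
  | tmul h w =>
    simp only [TensorProduct.comm_tmul, TensorProduct.assoc_tmul, LinearMap.lTensor_tmul,
      contractLeft_apply, dualTensorHom_apply]
    rw [TensorProduct.smul_tmul, smul_eq_mul, mul_one]
  | add x y hx hy =>
    simp only [map_add, TensorProduct.add_tmul, hx, hy, LinearMap.add_apply]

/-- Precomposition. -/
noncomputable def lcompG {A B C : Type} [AddCommGroup A] [Module k A] [AddCommGroup B] [Module k B]
    [AddCommGroup C] [Module k C] (f : A →ₗ[k] B) : (B →ₗ[k] C) →ₗ[k] (A →ₗ[k] C) := f.lcomp k C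

end GenD

variable (G : Type) [Group G] [Fintype G]

lemma pre_hom : dualTensorHom ℤ (IGcar G) (IGcar G) (preElt G) = LinearMap.id :=
  (dualTensorHomEquiv ℤ (IGcar G) (IGcar G)).apply_symm_apply LinearMap.id

/-- Evaluation. -/
noncomputable def evI : DIG G ⊗ IGrep G ⟶ 𝟙_ (Rep ℤ G) :=
  mkHom (A := DIG G ⊗ IGrep G) (B := 𝟙_ (Rep ℤ G)) (contractLeft ℤ (IGcar G)) (by
    intro g a
    have : contractLeft ℤ (IGcar G) ∘ₗ ((DIG G ⊗ IGrep G).ρ g) = contractLeft ℤ (IGcar G) := by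
      apply TensorProduct.ext'
      intro f x
      change Module.Dual ℤ (IGcar G) at f
      change IGcar G at x
      show f ((IGρ G) g⁻¹ (IGρ G g x)) = f x
      simp
    exact LinearMap.congr_fun this a)

variable {G} in
lemma rep_ext {A B : Rep.{0} ℤ G} (f f' : A ⟶ B)
    (h : f.hom.toLinearMap = f'.hom.toLinearMap) : f = f' := by
  apply Rep.hom_ext
  apply Representation.IntertwiningMap.ext
  exact h

/-- The duality between `I` and its dual. -/
@[reducible] noncomputable def epI : ExactPairing (IGrep G) (DIG G) where
  coevaluation' := coev G
  evaluation' := evI G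
  coevaluation_evaluation' := by
    refine rep_ext _ _ (TensorProduct.ext' fun f z => ?_)
    change Module.Dual ℤ (IGcar G) at f
    change ℤ at z
    show (contractLeft ℤ (IGcar G)).rTensor (Module.Dual ℤ (IGcar G))
      ((TensorProduct.assoc ℤ _ _ _).symm
      (f ⊗ₜ[ℤ] (z • (TensorProduct.comm ℤ _ _ (preElt G))))) = (1 : ℤ) ⊗ₜ[ℤ] (z • f)
    rw [TensorProduct.tmul_smul, map_smul, map_smul, tri_one, pre_hom, LinearMap.comp_id,
      TensorProduct.tmul_smul]
  evaluation_coevaluation' := by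
    refine rep_ext _ _ (TensorProduct.ext' fun z v => ?_)
    change IGcar G at v
    change ℤ at z
    show (contractLeft ℤ (IGcar G)).lTensor (IGcar G)
      ((TensorProduct.assoc ℤ _ _ _)
      ((z • (TensorProduct.comm ℤ _ _ (preElt G))) ⊗ₜ[ℤ] v)) = (z • v) ⊗ₜ[ℤ] (1 : ℤ)
    rw [← TensorProduct.smul_tmul', map_smul, map_smul, tri_two, pre_hom, LinearMap.id_apply,
      ← TensorProduct.smul_tmul']

/-- The duality between `Jp` and `Jn`. -/
@[reducible] noncomputable def epJp : ∀ n : ℕ, ExactPairing (Jp G n) (Jn G n)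
  | 0 => exactPairingUnit
  | n + 1 => by
    letI := epJp n
    letI := epI G
    exact @exactPairingCongrRight _ _ _ (Jp G n ⊗ IGrep G) (Jn G n ⊗ DIG G) (DIG G ⊗ Jn G n)
      ExactPairing.tensor (β_ _ _)

/-- The duality for `J`. -/
@[reducible] noncomputable def epJ : ∀ n : ℤ, ExactPairing (J G (-n)) (J G n)
  | .ofNat n => by
    letI := epJp G n
    have h : ExactPairing (Jn G n) (Jp G n) := BraidedCategory.exactPairing_swap _ _
    rw [← J_neg] at h
    exact h
  | .negSucc n => epJp G (n + 1)

/-- Internal hom out of `J`. -/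
noncomputable def thJ (n : ℤ) : Rep.ihom (J G n) ≅ tensorLeft (J G (-n)) :=
  letI := epJ G n
  (ihom.adjunction (J G n)).rightAdjointUniq (tensorLeftAdjunction (J G (-n)) (J G n))

lemma finIG : Module.Finite ℤ (IGrep G).V := inferInstanceAs (Module.Finite ℤ (IGcar G))

lemma finDIG : Module.Finite ℤ (DIG G).V :=
  inferInstanceAs (Module.Finite ℤ (Module.Dual ℤ (IGcar G)))

lemma finOne : Module.Finite ℤ (𝟙_ (Rep.{0} ℤ G)).V :=
  inferInstanceAs (Module.Finite ℤ ℤ)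

variable {G} in
lemma finTensor {A B : Rep.{0} ℤ G} (hA : Module.Finite ℤ A.V) (hB : Module.Finite ℤ B.V) :
    Module.Finite ℤ (A ⊗ B).V :=
  inferInstanceAs (Module.Finite ℤ (A.V ⊗[ℤ] B.V))

lemma finJp : ∀ n, Module.Finite ℤ (Jp G n).V
  | 0 => finOne G
  | n + 1 => finTensor (finJp n) (finIG G)

lemma finJn : ∀ n, Module.Finite ℤ (Jn G n).V
  | 0 => finOne G
  | n + 1 => finTensor (finJn n) (finDIG G)

lemma finJ : ∀ n, Module.Finite ℤ (J G n).V
  | .ofNat n => finJp G n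
  | .negSucc n => finJn G (n + 1)

variable {G}

/-- Transport of the functor in the hypothesis. -/
noncomputable def PhiIso (i : ℤ) (X : Rep.{0} ℤ G) :
    tensorLeft (J G (-i) ⊗ X) ⋙ tensorRight (IGrep G) ≅
      tensorRight (IGrep G) ⋙ tensorLeft X ⋙ Rep.ihom (J G i) :=
  NatIso.ofComponents (fun A => α_ _ _ _ ≪≫ α_ _ _ _ ≪≫
      ((thJ G i).app (X ⊗ (A ⊗ IGrep G))).symm) (by
    intro A B φ
    have h := (thJ G i).inv.naturality (X ◁ (φ ▷ IGrep G))
    dsimp at h ⊢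
    simp only [Category.assoc]
    rw [← h]
    simp)

/-- Transport of the functor in the conclusion. -/
noncomputable def PsiIso (X Y : Rep.{0} ℤ G) :
    Rep.ihom X ⋙ Rep.ihom Y ≅ Rep.ihom (Y ⊗ X) :=
  ((ihom.adjunction Y).comp (ihom.adjunction X)).rightAdjointUniq
    ((ihom.adjunction (Y ⊗ X)).ofNatIsoLeft
      ((tensoringLeft (Rep.{0} ℤ G)).mapIso (β_ Y X) ≪≫ tensorLeftTensor X Y))

lemma H0Tmap_mk {W W' : Rep.{0} ℤ G} (f : W ⟶ W') (v : W.V) (hv : v ∈ W.ρ.invariants) :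
    H0Tmap f (tate0mk (ρ := W.ρ) v hv) = tate0mk (ρ := W'.ρ) (f.hom v)
      (invariants_comp _ (fun g v => Rep.hom_comm_apply f g v) v hv) := rfl

lemma H0Tmap_id (W : Rep.{0} ℤ G) (z : H0T W) : H0Tmap (𝟙 W) z = z := by
  revert z
  exact tate0_ind (σ := W.ρ) fun v hv => rfl

lemma H0Tmap_comp {W W' W'' : Rep.{0} ℤ G} (f : W ⟶ W') (f' : W' ⟶ W'') (z : H0T W) :
    H0Tmap (f ≫ f') z = H0Tmap f' (H0Tmap f z) := by
  revert z
  exact tate0_ind (σ := W.ρ) fun v hv => rfl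

/-- Isomorphisms induce isomorphisms on `Ĥ⁰`. -/
noncomputable def H0Tiso {W W' : Rep.{0} ℤ G} (a : W ≅ W') : H0T W ≃+ H0T W' where
  toFun := H0Tmap a.hom
  invFun := H0Tmap a.inv
  left_inv z := by rw [← H0Tmap_comp, a.hom_inv_id, H0Tmap_id]
  right_inv z := by rw [← H0Tmap_comp, a.inv_hom_id, H0Tmap_id]
  map_add' x y := map_add _ x y

lemma H0Tiso_nat {F F' : Rep.{0} ℤ G ⥤ Rep.{0} ℤ G} (a : F ≅ F') {A B : Rep.{0} ℤ G} (φ : A ⟶ B)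
    (z : H0T (F.obj A)) : H0Tiso (a.app B) (H0Tmap (F.map φ) z)
      = H0Tmap (F'.map φ) (H0Tiso (a.app A) z) := by
  show H0Tmap (a.hom.app B) _ = H0Tmap _ (H0Tmap (a.hom.app A) z)
  rw [← H0Tmap_comp, ← H0Tmap_comp, a.hom.naturality]

lemma H0Tiso_nat_symm {F F' : Rep.{0} ℤ G ⥤ Rep.{0} ℤ G} (a : F ≅ F') {A B : Rep.{0} ℤ G}
    (φ : A ⟶ B) (z : H0T (F'.obj A)) : (H0Tiso (a.app B)).symm (H0Tmap (F'.map φ) z)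
      = H0Tmap (F.map φ) ((H0Tiso (a.app A)).symm z) :=
  H0Tiso_nat a.symm φ z

/-- Precomposition on internal homs. -/
noncomputable def preR {P Q : Rep.{0} ℤ G} (f : P ⟶ Q) (A : Rep.{0} ℤ G) : hRep Q A ⟶ hRep P A :=
  mkHom (A := hRep Q A) (B := hRep P A) (lcompG (C := A.V) f.hom.toLinearMap) (by
    intro g a
    change Q.V →ₗ[ℤ] A.V at a
    refine LinearMap.ext fun p => ?_
    show A.ρ g (a (Q.ρ g⁻¹ (f.hom p))) = A.ρ g (a (f.hom (P.ρ g⁻¹ p)))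
    rw [Rep.hom_comm_apply f g⁻¹ p])

lemma preR_nat {P Q A B : Rep.{0} ℤ G} (f : P ⟶ Q) (φ : A ⟶ B) :
    (Rep.ihom Q).map φ ≫ preR f B = preR f A ≫ (Rep.ihom P).map φ := rfl

lemma preR_inv {P Q : Rep.{0} ℤ G} (f : P ⟶ Q) (k : Q ⟶ P) (h : StEq (f ≫ k) (𝟙 _))
    (A : Rep.{0} ℤ G) (z : H0T (hRep P A)) :
    H0Tmap (preR f A) (H0Tmap (preR k A) z) = z := by
  obtain ⟨h, hh⟩ := h
  revert z
  refine tate0_ind (σ := (hRep P A).ρ) fun v hv => ?_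
  change P.V →ₗ[ℤ] A.V at v
  refine (tate0mk_eq (σ := (hRep P A).ρ) _ _).2 ⟨v ∘ₗ h, ?_⟩
  refine LinearMap.ext fun p => ?_
  refine (hRep_norm P A (v ∘ₗ h) p).trans ?_
  have e2 : ∀ g, A.ρ g (v (h (P.ρ g⁻¹ p))) = v (P.ρ g (h (P.ρ g⁻¹ p))) := by
    intro g
    have := LinearMap.congr_fun (hv g) (P.ρ g (h (P.ρ g⁻¹ p)))
    refine Eq.trans ?_ this
    show _ = A.ρ g (v (P.ρ g⁻¹ (P.ρ g (h (P.ρ g⁻¹ p)))))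
    simp
  show ∑ g, A.ρ g (v (h (P.ρ g⁻¹ p))) = v (k.hom (f.hom p)) - v p
  simp only [e2]
  rw [← map_sum, ← hh, map_sub]
  rfl

/-- Stable equivalences induce isomorphisms. -/
noncomputable def preE {P Q : Rep.{0} ℤ G} (f : P ⟶ Q) (k : Q ⟶ P) (h : StEq (f ≫ k) (𝟙 _))
    (h' : StEq (k ≫ f) (𝟙 _)) (A : Rep.{0} ℤ G) : H0T (hRep Q A) ≃+ H0T (hRep P A) where
  toFun := H0Tmap (preR f A)
  invFun := H0Tmap (preR k A)
  left_inv z := preR_inv k f h' A z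
  right_inv z := preR_inv f k h A z
  map_add' x y := map_add _ x y

lemma preE_nat {P Q : Rep.{0} ℤ G} (f : P ⟶ Q) (k : Q ⟶ P) (h : StEq (f ≫ k) (𝟙 _))
    (h' : StEq (k ≫ f) (𝟙 _)) {A B : Rep.{0} ℤ G} (φ : A ⟶ B) (z : H0T (hRep Q A)) :
    preE f k h h' B (H0Tmap ((Rep.ihom Q).map φ) z)
      = H0Tmap ((Rep.ihom P).map φ) (preE f k h h' A z) := by
  show H0Tmap (preR f B) _ = H0Tmap _ (H0Tmap (preR f A) z)
  rw [← H0Tmap_comp, ← H0Tmap_comp, preR_nat]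

theorem main_aux (X X' : Rep.{0} ℤ G)
    (hX : Module.Finite ℤ X.V) (hX' : Module.Finite ℤ X'.V) (i s : ℤ)
    (e : ∀ A : Rep.{0} ℤ G, tate i (X' ⊗ A) ≃+ tate s (X ⊗ A))
    (he : ∀ {A B : Rep.{0} ℤ G} (φ : A ⟶ B) (z : tate i (X' ⊗ A)),
        e B (tmap i (X' ◁ φ) z) = tmap s (X ◁ φ) (e A z)) :
    ∃ (e : ∀ A : Rep.{0} ℤ G, tate (-s) (hRep X A) ≃+ tate (-i) (hRep X' A)),
    ∀ {A B : Rep.{0} ℤ G} (φ : A ⟶ B) (z : tate (-s) (hRep X A)),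
      e B (tmap (-s) ((Rep.ihom X).map φ) z) = tmap (-i) ((Rep.ihom X').map φ) (e A z) := by
  let E : ∀ A : Rep.{0} ℤ G, H0T (((J G (-i) ⊗ X') ⊗ A) ⊗ IGrep G) ≃+
      H0T (((J G (-s) ⊗ X) ⊗ A) ⊗ IGrep G) := fun A =>
    ((H0Tiso ((PhiIso i X').app A)).trans (e (A ⊗ IGrep G))).trans
      (H0Tiso ((PhiIso s X).app A)).symm
  obtain ⟨f, k, h, h'⟩ := core (finTensor (finJ G (-i)) hX') (finTensor (finJ G (-s)) hX) E (by
    intro A B φ z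
    have h1 := H0Tiso_nat (PhiIso i X') φ z
    have h2 := he (φ ▷ IGrep G) (H0Tiso ((PhiIso i X').app A) z)
    have h3 := H0Tiso_nat_symm (PhiIso s X) φ (e _ (H0Tiso ((PhiIso i X').app A) z))
    refine Eq.trans ?_ h3
    refine congrArg (H0Tiso ((PhiIso s X).app B)).symm ?_
    exact (congrArg (e (B ⊗ IGrep G)) h1).trans h2)
  refine ⟨fun A => ((H0Tiso ((PsiIso X (J G (-s))).app A)).trans (preE f k h h' A)).trans
    (H0Tiso ((PsiIso X' (J G (-i))).app A)).symm, ?_⟩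
  intro A B φ z
  have h1 := H0Tiso_nat (PsiIso X (J G (-s))) φ z
  have h2 := preE_nat f k h h' φ (H0Tiso ((PsiIso X (J G (-s))).app A) z)
  have h3 := H0Tiso_nat_symm (PsiIso X' (J G (-i))) φ
    (preE f k h h' A (H0Tiso ((PsiIso X (J G (-s))).app A) z))
  refine Eq.trans ?_ h3
  refine congrArg (H0Tiso ((PsiIso X' (J G (-i))).app B)).symm ?_
  exact (congrArg (preE f k h h' B) h1).trans h2

end Enc

open CategoryTheory MonoidalCategory Enc

theorem statement17 (G : Type) [Group G] [Fintype G] (X X' : Rep ℤ G)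
    (hX : Module.Finite ℤ X.V) (hX' : Module.Finite ℤ X'.V) (i r : ℤ)
    (e : ∀ A : Rep ℤ G, tate i (X' ⊗ A) ≃+ tate (i + r) (X ⊗ A))
    (he : ∀ {A B : Rep ℤ G} (φ : A ⟶ B) (z : tate i (X' ⊗ A)),
        e B (tmap i (X' ◁ φ) z) = tmap (i + r) (X ◁ φ) (e A z)) :
    IsEncodingPair r X X' := by
  have key := main_aux X X' hX hX' i (i + r) e he
  have h : -i = -(i + r) + r := by ring
  rw [h] at key
  exact ⟨-(i + r), key⟩
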